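/- If $\tau$ is in the limit circle case at both endpoints $a$ and $b$, then the spectrum of any self-adjoint realization $S$ consists of eigenvalues that are the zeros of an entire function of Cartwright class; consequently, the eigenvalues have convergence exponent at most one: $\inf\{\omega\ge 0 : \sum_{\lambda\in\sigma(S)} (1+|\lambda|^{\omega})^{-1} < \infty\} \le 1$. Moreover, if $S$ is semibounded from above or below, then $\sum_{\lambda\in\sigma(S)} (1+|\lambda|)^{-1} < \infty$. -/

import Mathlib

open MeasureTheory Set Filter Complex Topology ComplexConjugate

noncomputable section

/-- `f` is locally absolutely continuous on `(a,b)` with a.e. derivative `g`,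
encoded via the integral representation. -/
def HasACDeriv (a b : ℝ) (f g : ℝ → ℂ) : Prop :=
  ∀ x ∈ Set.Ioo a b, ∀ y ∈ Set.Ioo a b,
    IntervalIntegrable g volume y x ∧ f x = f y + ∫ t in y..x, g t

/-- `f` lies in the domain `𝔇_τ` with first quasi-derivative `fq = p (f' + s f)` and
`τ f = w`, encoded via the equivalent first order system
`(f, f^{[1]})' = ((-s, 1/p), (q - 0·r, s)) (f, f^{[1]}) - (0, r·w)`. -/
structure SLSys (a b : ℝ) (p q r s : ℝ → ℝ) (f fq w : ℝ → ℂ) : Prop where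
  fst : HasACDeriv a b f fun x => fq x / (p x : ℂ) - (s x : ℂ) * f x
  snd : HasACDeriv a b fq fun x => (s x : ℂ) * fq x + (q x : ℂ) * f x - (r x : ℂ) * w x

/-- Standing hypothesis on the coefficients `p, q, r, s` on `(a,b)`:
real-valued and measurable, `p⁻¹, q, r, s ∈ L¹_loc((a,b))`, `p ≠ 0` and `r > 0` a.e. -/
structure SLHyp (a b : ℝ) (p q r s : ℝ → ℝ) : Prop where
  lt : a < b
  mp : Measurable p
  mq : Measurable q
  mr : Measurable r
  ms : Measurable s
  ip : ∀ x ∈ Set.Ioo a b, ∀ y ∈ Set.Ioo a b,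
    IntervalIntegrable (fun t => (p t)⁻¹) volume y x
  iq : ∀ x ∈ Set.Ioo a b, ∀ y ∈ Set.Ioo a b, IntervalIntegrable q volume y x
  ir : ∀ x ∈ Set.Ioo a b, ∀ y ∈ Set.Ioo a b, IntervalIntegrable r volume y x
  is' : ∀ x ∈ Set.Ioo a b, ∀ y ∈ Set.Ioo a b, IntervalIntegrable s volume y x
  pne : ∀ᵐ t ∂(volume.restrict (Set.Ioo a b)), p t ≠ 0
  rpos : ∀ᵐ t ∂(volume.restrict (Set.Ioo a b)), 0 < r t

/-- The modified Wronskian `W(f,g)(x) = f(x) g^{[1]}(x) - f^{[1]}(x) g(x)`. -/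
def Wr (f fq g gq : ℝ → ℂ) (x : ℝ) : ℂ := f x * gq x - fq x * g x

/-- `(v, vq)` belongs to the maximal domain: `v ∈ 𝔇_τ` with `τ v = vw` and both `v` and
`τ v` square integrable w.r.t. `r dx`. -/
structure MaxDom (a b : ℝ) (p q r s : ℝ → ℝ) (v vq vw : ℝ → ℂ) : Prop where
  sys : SLSys a b p q r s v vq vw
  l2v : IntegrableOn (fun x => ‖v x‖ ^ 2 * r x) (Set.Ioo a b)
  l2w : IntegrableOn (fun x => ‖vw x‖ ^ 2 * r x) (Set.Ioo a b)

/-- The Cartwright class: entire, of finite exponential type, with finite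
logarithmic integral. -/
def CartwrightClass (F : ℂ → ℂ) : Prop :=
  Differentiable ℂ F ∧ (∃ C τ : ℝ, ∀ z : ℂ, ‖F z‖ ≤ C * Real.exp (τ * ‖z‖)) ∧
  Integrable (fun t : ℝ => Real.log (max 1 ‖F (t : ℂ)‖) / (1 + t ^ 2))

/-- The spectrum (= set of eigenvalues) of the self-adjoint realization `S` of `τ`
with separated boundary conditions generated by `v` at `a` and `w` at `b`. -/
def specSet (a b : ℝ) (p q r s : ℝ → ℝ) (v vq w wq : ℝ → ℂ) : Set ℝ :=
  {t : ℝ | ∃ u uq : ℝ → ℂ, SLSys a b p q r s u uq (fun x => (t : ℂ) * u x) ∧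
    (∃ x ∈ Set.Ioo a b, u x ≠ 0) ∧
    IntegrableOn (fun x => ‖u x‖ ^ 2 * r x) (Set.Ioo a b) ∧
    Tendsto (Wr u uq (fun x => conj (v x)) (fun x => conj (vq x))) (𝓝[>] a) (𝓝 0) ∧
    Tendsto (Wr u uq (fun x => conj (w x)) (fun x => conj (wq x))) (𝓝[<] b) (𝓝 0)}

/-- absolutely continuous on `I` with derivative `g`. -/
def ACD (I : Set ℝ) (f g : ℝ → ℂ) : Prop :=
  ∀ x ∈ I, ∀ y ∈ I, IntervalIntegrable g volume y x ∧ f x = f y + ∫ t in y..x, g t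

lemma ac_of_dist_le {f : ℝ → ℂ} {α : ℝ → ℝ} {a b : ℝ}
    (hα : AbsolutelyContinuousOnInterval α a b)
    (h : ∀ x ∈ uIcc a b, ∀ y ∈ uIcc a b, dist (f x) (f y) ≤ dist (α x) (α y)) :
    AbsolutelyContinuousOnInterval f a b := by
  rw [absolutelyContinuousOnInterval_iff] at hα ⊢
  intro ε hε
  obtain ⟨δ, hδ, H⟩ := hα ε hε
  refine ⟨δ, hδ, fun E hE hE2 => lt_of_le_of_lt (Finset.sum_le_sum fun i hi => ?_) (H E hE hE2)⟩
  exact h _ (hE.1 i hi).1 _ (hE.1 i hi).2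

lemma ac_integral {g : ℝ → ℂ} {a b c : ℝ} (hg : IntervalIntegrable g volume a b)
    (hc : c ∈ uIcc a b) :
    AbsolutelyContinuousOnInterval (fun x => ∫ t in c..x, g t) a b := by
  have hsub : ∀ x ∈ uIcc a b, ∀ y ∈ uIcc a b, IntervalIntegrable g volume x y :=
    fun x hx y hy => hg.mono_set (uIcc_subset_uIcc hx hy)
  refine ac_of_dist_le
    (hg.norm.absolutelyContinuousOnInterval_intervalIntegral hc) ?_
  intro x hx y hy
  rw [dist_eq_norm, dist_eq_norm,
    intervalIntegral.integral_interval_sub_left (hsub c hc x hx) (hsub c hc y hy),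
    intervalIntegral.integral_interval_sub_left (hsub c hc x hx).norm (hsub c hc y hy).norm]
  exact intervalIntegral.norm_integral_le_abs_integral_norm

lemma ACD.sub_uIcc {I : Set ℝ} (hI : I.OrdConnected) {x y : ℝ} (hx : x ∈ I) (hy : y ∈ I) :
    uIcc x y ⊆ I := hI.uIcc_subset hx hy

lemma ACD.ac {I : Set ℝ} (hI : I.OrdConnected) {f g : ℝ → ℂ} (h : ACD I f g) {x y : ℝ}
    (hx : x ∈ I) (hy : y ∈ I) : AbsolutelyContinuousOnInterval f x y := by
  have h1 := (h y hy x hx).1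
  refine ac_of_dist_le
    (h1.norm.absolutelyContinuousOnInterval_intervalIntegral left_mem_uIcc) ?_
  intro s hs t ht
  have hsI := ACD.sub_uIcc hI hx hy hs
  have htI := ACD.sub_uIcc hI hx hy ht
  rw [dist_eq_norm, dist_eq_norm,
    intervalIntegral.integral_interval_sub_left (h s hsI x hx).1.norm (h t htI x hx).1.norm,
    (h s hsI t htI).2, add_sub_cancel_left]
  exact intervalIntegral.norm_integral_le_abs_integral_norm

lemma ACD.ae_deriv {I : Set ℝ} (hI : I.OrdConnected) {f g : ℝ → ℂ} (h : ACD I f g) {x y : ℝ}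
    (hx : x ∈ I) (hy : y ∈ I) : ∀ᵐ t, t ∈ uIcc x y → HasDerivAt f (g t) t := by
  have h1 := (h y hy x hx).1.ae_hasDerivAt_integral
  have hne : ∀ c : ℝ, ∀ᵐ t : ℝ, t ≠ c := fun c => by simp [ae_iff, measure_singleton]
  filter_upwards [h1, hne x, hne y] with t ht htx hty htI
  have h2 := (ht htI x left_mem_uIcc).const_add (f x)
  refine h2.congr_of_eventuallyEq ?_
  have hmem : uIcc x y ∈ 𝓝 t := by
    rw [uIcc] at htI ⊢
    refine Icc_mem_nhds ?_ ?_
    · refine lt_of_le_of_ne htI.1 ?_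
      rcases min_choice x y with h | h <;> rw [h] <;> [exact htx.symm; exact hty.symm]
    · refine lt_of_le_of_ne htI.2 ?_
      rcases max_choice x y with h | h <;> rw [h] <;> [exact htx; exact hty]
  filter_upwards [hmem] with s hs
  exact (h s (ACD.sub_uIcc hI hx hy hs) x hx).2

lemma ACD.continuousOn_uIcc {I : Set ℝ} (hI : I.OrdConnected) {f g : ℝ → ℂ} (h : ACD I f g)
    {x y : ℝ} (hx : x ∈ I) (hy : y ∈ I) : ContinuousOn f (uIcc x y) :=
  (h.ac hI hx hy).continuousOn

lemma ACD.mul {I : Set ℝ} (hI : I.OrdConnected) {f f' g g' : ℝ → ℂ} (hf : ACD I f f')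
    (hg : ACD I g g') : ACD I (fun x => f x * g x) (fun x => f' x * g x + f x * g' x) := by
  intro x hx y hy
  have i1 : IntervalIntegrable (fun x => f' x * g x + f x * g' x) volume y x :=
    ((hf x hx y hy).1.mul_continuousOn (hg.continuousOn_uIcc hI hy hx)).add
      ((hg x hx y hy).1.continuousOn_mul (hf.continuousOn_uIcc hI hy hx))
  refine ⟨i1, ?_⟩
  have hac : AbsolutelyContinuousOnInterval
      (fun t => f t * g t - ∫ s in y..t, (f' s * g s + f s * g' s)) y x := by
    refine AbsolutelyContinuousOnInterval.sub (f := fun t => f t * g t) ?_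
      (ac_integral i1 left_mem_uIcc)
    exact (hf.ac hI hy hx).smul (hg.ac hI hy hx)
  obtain ⟨C, hC⟩ := hac.const_of_ae_hasDerivAt_zero (by
    filter_upwards [hf.ae_deriv hI hy hx, hg.ae_deriv hI hy hx, i1.ae_hasDerivAt_integral]
      with t h1 h2 h3 ht
    have := ((h1 ht).mul (h2 ht)).sub (h3 ht y left_mem_uIcc)
    rw [sub_self] at this
    exact this)
  have e1 := hC y left_mem_uIcc
  have e2 := hC x right_mem_uIcc
  simp only [intervalIntegral.integral_same, sub_zero] at e1
  beta_reduce
  rw [e1, ← e2]; ring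

lemma ACD.add {I : Set ℝ} {f f' g g' : ℝ → ℂ} (hf : ACD I f f')
    (hg : ACD I g g') : ACD I (fun x => f x + g x) (fun x => f' x + g' x) := by
  intro x hx y hy
  obtain ⟨a1, a2⟩ := hf x hx y hy
  obtain ⟨b1, b2⟩ := hg x hx y hy
  refine ⟨a1.add b1, ?_⟩
  beta_reduce
  rw [intervalIntegral.integral_add a1 b1, a2, b2]; ring

lemma ACD.const_mul {I : Set ℝ} {f f' : ℝ → ℂ} (c : ℂ) (hf : ACD I f f') :
    ACD I (fun x => c * f x) (fun x => c * f' x) := by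
  intro x hx y hy
  obtain ⟨a1, a2⟩ := hf x hx y hy
  refine ⟨a1.const_mul c, ?_⟩
  beta_reduce
  rw [intervalIntegral.integral_const_mul, a2]; ring

lemma ACD.sub {I : Set ℝ} {f f' g g' : ℝ → ℂ} (hf : ACD I f f')
    (hg : ACD I g g') : ACD I (fun x => f x - g x) (fun x => f' x - g' x) := by
  intro x hx y hy
  obtain ⟨a1, a2⟩ := hf x hx y hy
  obtain ⟨b1, b2⟩ := hg x hx y hy
  refine ⟨a1.sub b1, ?_⟩
  beta_reduce
  rw [intervalIntegral.integral_sub a1 b1, a2, b2]; ring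

lemma ACD.clm {I : Set ℝ} {f f' : ℝ → ℂ} (L : ℂ →L[ℝ] ℂ) (hf : ACD I f f') :
    ACD I (fun x => L (f x)) (fun x => L (f' x)) := by
  intro x hx y hy
  obtain ⟨a1, a2⟩ := hf x hx y hy
  refine ⟨⟨L.integrable_comp a1.1, L.integrable_comp a1.2⟩, ?_⟩
  beta_reduce
  rw [L.intervalIntegral_comp_comm a1, a2, map_add]

lemma ACD.conj {I : Set ℝ} {f f' : ℝ → ℂ} (hf : ACD I f f') :
    ACD I (fun x => conj (f x)) (fun x => conj (f' x)) :=
  hf.clm (conjCLE : ℂ →L[ℝ] ℂ)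

lemma ACD.re {I : Set ℝ} {f f' : ℝ → ℂ} (hf : ACD I f f') :
    ACD I (fun x => ((f x).re : ℂ)) (fun x => ((f' x).re : ℂ)) :=
  hf.clm (ofRealCLM ∘L reCLM)

lemma ACD.congr {I : Set ℝ} (hI : I.OrdConnected) {f f₁ g g₁ : ℝ → ℂ} (h : ACD I f g)
    (hf : ∀ x ∈ I, f₁ x = f x) (hg : ∀ x ∈ I, g₁ x = g x) : ACD I f₁ g₁ := by
  intro x hx y hy
  obtain ⟨a1, a2⟩ := h x hx y hy
  have hs : EqOn g g₁ (uIcc y x) := fun t ht => (hg t (ACD.sub_uIcc hI hy hx ht)).symm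
  refine ⟨a1.congr (fun t ht => hs (uIoc_subset_uIcc ht)), ?_⟩
  rw [hf x hx, hf y hy, a2, intervalIntegral.integral_congr hs]

lemma ACD.mono {I J : Set ℝ} {f g : ℝ → ℂ} (h : ACD I f g) (hJ : J ⊆ I) : ACD J f g :=
  fun x hx y hy => h x (hJ hx) y (hJ hy)

lemma ACD.congr_ae {I : Set ℝ} (hI : I.OrdConnected) {f g g₁ : ℝ → ℂ} (h : ACD I f g)
    (hg : ∀ᵐ t, t ∈ I → g t = g₁ t) : ACD I f g₁ := by
  intro x hx y hy
  obtain ⟨a1, a2⟩ := h x hx y hy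
  have hs : ∀ᵐ t, t ∈ uIoc y x → g t = g₁ t := by
    filter_upwards [hg] with t ht htt
    exact ht (ACD.sub_uIcc hI hy hx (uIoc_subset_uIcc htt))
  refine ⟨a1.congr_ae ?_, ?_⟩
  · rw [Filter.EventuallyEq, ae_restrict_iff' measurableSet_uIoc]; exact hs
  rw [a2, intervalIntegral.integral_congr_ae hs]

lemma ACD.const_of_zero {I : Set ℝ} (hI : I.OrdConnected) {f g : ℝ → ℂ} (h : ACD I f g)
    (hg : ∀ x ∈ I, g x = 0) : ∀ x ∈ I, ∀ y ∈ I, f x = f y := by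
  intro x hx y hy
  have h2 := (h.congr hI (g₁ := fun _ => 0) (fun _ _ => rfl) (fun t ht => (hg t ht).symm) x hx y hy).2
  simpa using h2

lemma ACD.continuousOn {I : Set ℝ} (hI : I.OrdConnected) {f g : ℝ → ℂ} (h : ACD I f g)
    {u v : ℝ} (hIu : I = Icc u v ∨ I = Ioo u v) : ContinuousOn f I := by
  rcases hIu with rfl | rfl
  · rcases le_or_gt u v with huv | huv
    · have := h.continuousOn_uIcc hI (left_mem_Icc.2 huv) (right_mem_Icc.2 huv)
      rwa [uIcc_of_le huv] at this
    · simp [Icc_eq_empty (not_le.2 huv)]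
  · intro x hx
    obtain ⟨y, hy⟩ := exists_between hx.1
    obtain ⟨z, hz⟩ := exists_between hx.2
    have h1 := h.continuousOn_uIcc hI (x := y) (y := z) ⟨hy.1, hy.2.trans hx.2⟩
      ⟨hx.1.trans hz.1, hz.2⟩
    rw [uIcc_of_le (hy.2.trans hz.1).le] at h1
    exact (h1.continuousAt (Icc_mem_nhds hy.2 hz.1)).continuousWithinAt

/-- Neumann series terms of the system `Y' = z K Y`, `Y(c) = (y1, y2)`. -/
def neu (k11 k12 k21 k22 : ℝ → ℂ) (c : ℝ) (y1 y2 : ℂ) : ℕ → ℝ → ℂ × ℂ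
  | 0 => fun _ => (y1, y2)
  | n + 1 => fun x =>
    (∫ t in c..x, (k11 t * (neu k11 k12 k21 k22 c y1 y2 n t).1
        + k12 t * (neu k11 k12 k21 k22 c y1 y2 n t).2),
     ∫ t in c..x, (k21 t * (neu k11 k12 k21 k22 c y1 y2 n t).1
        + k22 t * (neu k11 k12 k21 k22 c y1 y2 n t).2))

/-- interval integrability between all points of `I`. -/
def IntOn (I : Set ℝ) (k : ℝ → ℂ) : Prop := ∀ x ∈ I, ∀ y ∈ I, IntervalIntegrable k volume y x

lemma IntOn.acd {I : Set ℝ} {k : ℝ → ℂ} (h : IntOn I k) {c : ℝ} (hc : c ∈ I) :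
    ACD I (fun x => ∫ t in c..x, k t) k := by
  intro x hx y hy
  refine ⟨h x hx y hy, ?_⟩
  beta_reduce
  rw [intervalIntegral.integral_add_adjacent_intervals (h y hy c hc) (h x hx y hy)]

lemma IntOn.mulACD {I : Set ℝ} (_ : I.OrdConnected) {k f : ℝ → ℂ} (h : IntOn I k)
    (hf : ∀ x ∈ I, ∀ y ∈ I, ContinuousOn f (uIcc x y)) : IntOn I (fun t => k t * f t) :=
  fun x hx y hy => (h x hx y hy).mul_continuousOn (hf y hy x hx)

lemma IntOn.add {I : Set ℝ} {k l : ℝ → ℂ} (h : IntOn I k) (hl : IntOn I l) :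
    IntOn I (fun t => k t + l t) := fun x hx y hy => (h x hx y hy).add (hl x hx y hy)


lemma neu_cont {I : Set ℝ} (hI : I.OrdConnected) {k11 k12 k21 k22 : ℝ → ℂ} (h11 : IntOn I k11)
    (h12 : IntOn I k12) (h21 : IntOn I k21) (h22 : IntOn I k22) {c : ℝ} (hc : c ∈ I) (y1 y2 : ℂ)
    (n : ℕ) : ∀ x ∈ I, ∀ y ∈ I,
    ContinuousOn (fun t => (neu k11 k12 k21 k22 c y1 y2 n t).1) (uIcc x y) ∧
    ContinuousOn (fun t => (neu k11 k12 k21 k22 c y1 y2 n t).2) (uIcc x y) := by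
  induction n with
  | zero => intro x hx y hy; exact ⟨continuousOn_const, continuousOn_const⟩
  | succ n ih =>
    intro x hx y hy
    have e1 := (((h11.mulACD hI fun x hx y hy => (ih x hx y hy).1).add
      (h12.mulACD hI fun x hx y hy => (ih x hx y hy).2)).acd hc).continuousOn_uIcc hI hx hy
    have e2 := (((h21.mulACD hI fun x hx y hy => (ih x hx y hy).1).add
      (h22.mulACD hI fun x hx y hy => (ih x hx y hy).2)).acd hc).continuousOn_uIcc hI hx hy
    exact ⟨e1, e2⟩

lemma neu_acd {I : Set ℝ} (hI : I.OrdConnected) {k11 k12 k21 k22 : ℝ → ℂ} (h11 : IntOn I k11)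
    (h12 : IntOn I k12) (h21 : IntOn I k21) (h22 : IntOn I k22) {c : ℝ} (hc : c ∈ I) (y1 y2 : ℂ)
    (n : ℕ) :
    ACD I (fun t => (neu k11 k12 k21 k22 c y1 y2 (n+1) t).1)
      (fun t => k11 t * (neu k11 k12 k21 k22 c y1 y2 n t).1
        + k12 t * (neu k11 k12 k21 k22 c y1 y2 n t).2) ∧
    ACD I (fun t => (neu k11 k12 k21 k22 c y1 y2 (n+1) t).2)
      (fun t => k21 t * (neu k11 k12 k21 k22 c y1 y2 n t).1
        + k22 t * (neu k11 k12 k21 k22 c y1 y2 n t).2) := by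
  have ih := neu_cont hI h11 h12 h21 h22 hc y1 y2 n
  exact ⟨((h11.mulACD hI fun x hx y hy => (ih x hx y hy).1).add
      (h12.mulACD hI fun x hx y hy => (ih x hx y hy).2)).acd hc,
      ((h21.mulACD hI fun x hx y hy => (ih x hx y hy).1).add
      (h22.mulACD hI fun x hx y hy => (ih x hx y hy).2)).acd hc⟩

/-- total size of the coefficient matrix -/
def kk (k11 k12 k21 k22 : ℝ → ℂ) (t : ℝ) : ℝ := ‖k11 t‖ + ‖k12 t‖ + ‖k21 t‖ + ‖k22 t‖

lemma kk_nonneg (k11 k12 k21 k22 : ℝ → ℂ) (t : ℝ) : 0 ≤ kk k11 k12 k21 k22 t := by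
  unfold kk; positivity

lemma pow_int {I : Set ℝ} (hI : I.OrdConnected) {K : ℝ → ℝ} (hK0 : ∀ t, 0 ≤ K t)
    (hK : ∀ x ∈ I, ∀ y ∈ I, IntervalIntegrable K volume y x) {c : ℝ} (hc : c ∈ I) (n : ℕ)
    {x : ℝ} (hx : x ∈ I) :
    |∫ t in c..x, K t * |∫ s in c..t, K s| ^ n| = |∫ s in c..x, K s| ^ (n+1) / (n+1) := by
  have hKc : IntOn I (fun t => (K t : ℂ)) := fun x hx y hy =>
    ⟨(hK x hx y hy).1.ofReal, (hK x hx y hy).2.ofReal⟩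
  have hα := hKc.acd hc
  have hpow : ∀ n : ℕ, ACD I (fun x => (∫ t in c..x, (K t : ℂ)) ^ (n+1))
      (fun x => (n+1) * ((∫ t in c..x, (K t : ℂ)) ^ n * K x)) := by
    intro n
    induction n with
    | zero => simpa using hα
    | succ n ih =>
      refine (ih.mul hI hα).congr hI (fun x _ => by ring) (fun x _ => ?_)
      push_cast; ring
  have h1 := (hpow n x hx c hc).2
  simp only [intervalIntegral.integral_same, ne_eq, Nat.add_eq_zero_iff, one_ne_zero, and_false,
    not_false_eq_true, zero_pow, zero_add, intervalIntegral.integral_const_mul,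
    intervalIntegral.integral_ofReal] at h1
  have h2 : (∫ s in c..x, K s) ^ (n+1) = (n+1) * ∫ t in c..x, (∫ s in c..t, K s) ^ n * K t := by
    have h3 : ∀ t, (((∫ s in c..t, K s : ℝ) : ℂ) ^ n * (K t : ℂ))
      = (((∫ s in c..t, K s) ^ n * K t : ℝ) : ℂ) := fun t => by push_cast; ring
    simp_rw [h3, intervalIntegral.integral_ofReal] at h1
    exact_mod_cast h1
  have h4 : |∫ t in c..x, K t * |∫ s in c..t, K s| ^ n|
      = |∫ t in c..x, (∫ s in c..t, K s) ^ n * K t| := by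
    rcases le_total c x with hcx | hcx
    · congr 1
      refine intervalIntegral.integral_congr fun t ht => ?_
      rw [uIcc_of_le hcx] at ht
      have : 0 ≤ ∫ s in c..t, K s := intervalIntegral.integral_nonneg ht.1 fun s _ => hK0 s
      simp only [abs_of_nonneg this]; ring
    · have h5 : ∫ t in c..x, K t * |∫ s in c..t, K s| ^ n
        = ∫ t in c..x, (-1)^n * ((∫ s in c..t, K s) ^ n * K t) := by
        refine intervalIntegral.integral_congr fun t ht => ?_
        rw [uIcc_of_ge hcx] at ht
        have : (∫ s in c..t, K s) ≤ 0 := by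
          rw [intervalIntegral.integral_symm]
          have := intervalIntegral.integral_nonneg (f := K) (μ := volume) ht.2 fun s _ => hK0 s
          linarith
        simp only [abs_of_nonpos this]
        rw [neg_pow]; ring
      rw [h5, intervalIntegral.integral_const_mul, abs_mul, abs_pow, abs_neg, abs_one, one_pow,
        one_mul]
  rw [h4, ← abs_pow, h2, abs_mul, abs_of_pos (by positivity : (0:ℝ) < n + 1)]
  field_simp


lemma kk_int {I : Set ℝ} {k11 k12 k21 k22 : ℝ → ℂ} (h11 : IntOn I k11)
    (h12 : IntOn I k12) (h21 : IntOn I k21) (h22 : IntOn I k22) : ∀ x ∈ I, ∀ y ∈ I, IntervalIntegrable (kk k11 k12 k21 k22) volume y x :=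
  fun x hx y hy => (((h11 x hx y hy).norm.add (h12 x hx y hy).norm).add
    (h21 x hx y hy).norm).add (h22 x hx y hy).norm

lemma neu_bound {I : Set ℝ} (hI : I.OrdConnected) {k11 k12 k21 k22 : ℝ → ℂ} (h11 : IntOn I k11)
    (h12 : IntOn I k12) (h21 : IntOn I k21) (h22 : IntOn I k22) {c : ℝ} (hc : c ∈ I) (y1 y2 : ℂ)
    (n : ℕ) : ∀ x ∈ I, 
    ‖(neu k11 k12 k21 k22 c y1 y2 n x).1‖ ≤
      (‖y1‖+‖y2‖) * |∫ s in c..x, kk k11 k12 k21 k22 s| ^ n / n.factorial ∧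
    ‖(neu k11 k12 k21 k22 c y1 y2 n x).2‖ ≤
      (‖y1‖+‖y2‖) * |∫ s in c..x, kk k11 k12 k21 k22 s| ^ n / n.factorial := by
  induction n with
  | zero => intro x hx; simp [neu]
  | succ n ih =>
    intro x hx
    set K := kk k11 k12 k21 k22 with hKdef
    have hK := kk_int h11 h12 h21 h22
    have hK0 := kk_nonneg k11 k12 k21 k22
    have key : ∀ p q : ℝ → ℂ, (∀ t, ‖p t‖ + ‖q t‖ ≤ K t) →
      ‖∫ t in c..x, (p t * (neu k11 k12 k21 k22 c y1 y2 n t).1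
        + q t * (neu k11 k12 k21 k22 c y1 y2 n t).2)‖
       ≤ (‖y1‖+‖y2‖) * |∫ s in c..x, K s| ^ (n+1) / (n+1).factorial := by
      intro p q hpq
      have hcont : ContinuousOn (fun t => ∫ s in c..t, K s) (uIcc c x) :=
        ((hK x hx c hc).absolutelyContinuousOnInterval_intervalIntegral left_mem_uIcc).continuousOn
      have hi : IntervalIntegrable (fun t => (‖y1‖+‖y2‖) / n.factorial *
          (K t * |∫ s in c..t, K s| ^ n)) volume c x :=
        ((hK x hx c hc).mul_continuousOn ((hcont.abs).pow n)).const_mul _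
      have := intervalIntegral.norm_integral_le_abs_of_norm_le (μ := volume) (a := c) (b := x)
        (f := fun t => (p t * (neu k11 k12 k21 k22 c y1 y2 n t).1
        + q t * (neu k11 k12 k21 k22 c y1 y2 n t).2))
        (g := fun t => (‖y1‖+‖y2‖) / n.factorial * (K t * |∫ s in c..t, K s| ^ n)) ?_ hi
      · refine this.trans ?_
        rw [intervalIntegral.integral_const_mul, abs_mul, pow_int hI hK0 hK hc n hx,
          abs_of_nonneg (by positivity), Nat.factorial_succ]
        push_cast
        apply le_of_eq
        field_simp
        rfl
      · refine (ae_restrict_iff' measurableSet_uIoc).2 (Eventually.of_forall fun t ht => ?_)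
        have htI := ACD.sub_uIcc hI hc hx (uIoc_subset_uIcc ht)
        obtain ⟨b1, b2⟩ := ih t htI
        set Z := (‖y1‖+‖y2‖) * |∫ s in c..t, K s| ^ n / n.factorial with hZ
        have hZ0 : 0 ≤ Z := by positivity
        calc _ ≤ ‖p t‖ * Z + ‖q t‖ * Z := by
              refine (norm_add_le _ _).trans ?_
              rw [norm_mul, norm_mul]
              gcongr
          _ = (‖p t‖ + ‖q t‖) * Z := by ring
          _ ≤ K t * Z := by gcongr; exact hpq t
          _ = _ := by rw [hZ]; ring
    exact ⟨key k11 k12 fun t => by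
        simp only [hKdef, kk]; linarith [norm_nonneg (k21 t), norm_nonneg (k22 t)],
      key k21 k22 fun t => by
        simp only [hKdef, kk]; linarith [norm_nonneg (k11 t), norm_nonneg (k12 t)]⟩


lemma summable_exp_bound (M α ρ : ℝ) :
    Summable (fun n : ℕ => ρ ^ n * (M * α ^ n / n.factorial)) := by
  have := (Real.summable_pow_div_factorial (ρ * α)).mul_left M
  refine this.congr fun n => ?_
  rw [mul_pow]; ring

lemma tsum_exp_bound (M α ρ : ℝ) :
    ∑' n : ℕ, ρ ^ n * (M * α ^ n / n.factorial) = M * Real.exp (α * ρ) := by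
  rw [Real.exp_eq_exp_ℝ, NormedSpace.exp_eq_tsum_div, ← tsum_mul_left]
  refine tsum_congr fun n => ?_
  rw [mul_pow]; ring

lemma entire_of_coef {c : ℕ → ℂ} {M α : ℝ} (h : ∀ n, ‖c n‖ ≤ M * α ^ n / n.factorial) :
    Differentiable ℂ (fun z => ∑' n, z ^ n * c n) ∧
    ∀ z, ‖∑' n, z ^ n * c n‖ ≤ M * Real.exp (α * ‖z‖) := by
  constructor
  · intro z
    have hd : DifferentiableOn ℂ (fun z => ∑' n, z ^ n * c n) (Metric.ball 0 (‖z‖+1)) := by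
      refine differentiableOn_tsum_of_summable_norm (summable_exp_bound M α (‖z‖+1)) ?_
        Metric.isOpen_ball ?_
      · intro n; fun_prop
      · intro n w hw
        rw [norm_mul, norm_pow]
        have hw' : ‖w‖ ≤ ‖z‖+1 := by simpa using (mem_ball_zero_iff.1 hw).le
        have := h n
        have h0 := (norm_nonneg _).trans this
        gcongr
    exact (hd z (by simp)).differentiableAt (Metric.isOpen_ball.mem_nhds (by simp))
  · intro z
    rw [← tsum_exp_bound]
    refine tsum_of_norm_bounded (summable_exp_bound M α ‖z‖).hasSum fun n => ?_
    rw [norm_mul, norm_pow]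
    have := h n
    gcongr

/-- sum of the Neumann series -/
def sol1 (k11 k12 k21 k22 : ℝ → ℂ) (c : ℝ) (y1 y2 : ℂ) (z : ℂ) (x : ℝ) : ℂ :=
  ∑' n : ℕ, z ^ n * (neu k11 k12 k21 k22 c y1 y2 n x).1

/-- sum of the Neumann series -/
def sol2 (k11 k12 k21 k22 : ℝ → ℂ) (c : ℝ) (y1 y2 : ℂ) (z : ℂ) (x : ℝ) : ℂ :=
  ∑' n : ℕ, z ^ n * (neu k11 k12 k21 k22 c y1 y2 n x).2

lemma sol_init (k11 k12 k21 k22 : ℝ → ℂ) (c : ℝ) (y1 y2 : ℂ) (z : ℂ) :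
    sol1 k11 k12 k21 k22 c y1 y2 z c = y1 ∧ sol2 k11 k12 k21 k22 c y1 y2 z c = y2 := by
  constructor
  · unfold sol1
    rw [tsum_eq_single 0]
    · simp [neu]
    · intro n hn
      obtain ⟨m, rfl⟩ := Nat.exists_eq_succ_of_ne_zero hn
      simp [neu]
  · unfold sol2
    rw [tsum_eq_single 0]
    · simp [neu]
    · intro n hn
      obtain ⟨m, rfl⟩ := Nat.exists_eq_succ_of_ne_zero hn
      simp [neu]

lemma series_acd {I : Set ℝ} (_ : I.OrdConnected) {p q : ℝ → ℂ} (hp : IntOn I p) (hq : IntOn I q)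
    {f g h : ℕ → ℝ → ℂ}
    (hcf : ∀ n, ∀ x ∈ I, ∀ y ∈ I, ContinuousOn (f n) (uIcc x y))
    (hcg : ∀ n, ∀ x ∈ I, ∀ y ∈ I, ContinuousOn (g n) (uIcc x y))
    (hh : ∀ n, ACD I (h (n+1)) (fun t => p t * f n t + q t * g n t))
    (h0 : ∀ x y, h 0 x = h 0 y)
    (hb : ∀ x ∈ I, ∀ y ∈ I, ∃ M α : ℝ, ∀ t ∈ uIcc x y, ∀ n,
      ‖f n t‖ ≤ M * α ^ n / n.factorial ∧ ‖g n t‖ ≤ M * α ^ n / n.factorial ∧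
      ‖h n t‖ ≤ M * α ^ n / n.factorial) (z : ℂ) :
    ACD I (fun x => ∑' n, z ^ n * h n x)
      (fun t => z * (p t * (∑' n, z ^ n * f n t) + q t * ∑' n, z ^ n * g n t)) := by
  intro x hx y hy
  obtain ⟨M, α, hM⟩ := hb y hy x hx
  have hsb := summable_exp_bound M α ‖z‖
  have sb : ∀ (w : ℕ → ℂ), (∀ n, ‖w n‖ ≤ M * α ^ n / n.factorial) →
      ∀ n, ‖z ^ n * w n‖ ≤ ‖z‖ ^ n * (M * α ^ n / n.factorial) := by
    intro w hw n
    rw [norm_mul, norm_pow]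
    have := hw n
    gcongr
  have sm : ∀ (w : ℕ → ℂ), (∀ n, ‖w n‖ ≤ M * α ^ n / n.factorial) →
      Summable fun n => z ^ n * w n := fun w hw => Summable.of_norm_bounded hsb (sb w hw)
  have cF : ContinuousOn (fun t => ∑' n, z ^ n * f n t) (uIcc y x) :=
    continuousOn_tsum (fun n => (hcf n y hy x hx).const_mul _) hsb
      fun n t ht => sb (fun n => f n t) (fun n => (hM t ht n).1) n
  have cG : ContinuousOn (fun t => ∑' n, z ^ n * g n t) (uIcc y x) :=
    continuousOn_tsum (fun n => (hcg n y hy x hx).const_mul _) hsb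
      fun n t ht => sb (fun n => g n t) (fun n => (hM t ht n).2.1) n
  refine ⟨(((hp x hx y hy).mul_continuousOn cF).add
    ((hq x hx y hy).mul_continuousOn cG)).const_mul z, ?_⟩
  have hsum := intervalIntegral.hasSum_integral_of_dominated_convergence (μ := volume)
    (a := y) (b := x) (F := fun n t => z * (p t * (z ^ n * f n t) + q t * (z ^ n * g n t)))
    (f := fun t => z * (p t * (∑' n, z ^ n * f n t) + q t * ∑' n, z ^ n * g n t))
    (fun n t => ‖z‖ * ((‖p t‖ + ‖q t‖) * (‖z‖ ^ n * (M * α ^ n / n.factorial))))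
    (fun n => ?_) (fun n => ?_) ?_ ?_ ?_
  · have e1 : ∀ n, ∫ t in y..x, z * (p t * (z ^ n * f n t) + q t * (z ^ n * g n t))
        = z ^ (n+1) * h (n+1) x - z ^ (n+1) * h (n+1) y := by
      intro n
      rw [(hh n x hx y hy).2, mul_add, add_sub_cancel_left, ← intervalIntegral.integral_const_mul]
      congr 1; ext t; ring
    simp_rw [e1] at hsum
    beta_reduce
    rw [← hsum.tsum_eq]
    have s1 := sm (fun n => h n x) fun n => (hM x right_mem_uIcc n).2.2
    have s2 := sm (fun n => h n y) fun n => (hM y left_mem_uIcc n).2.2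
    rw [s1.tsum_eq_zero_add, s2.tsum_eq_zero_add,
      ((summable_nat_add_iff 1).2 s1).tsum_sub ((summable_nat_add_iff 1).2 s2), h0 x y]
    ring
  · have : IntervalIntegrable (fun t => z * (p t * (z ^ n * f n t) + q t * (z ^ n * g n t)))
        volume y x := (((hp x hx y hy).mul_continuousOn ((hcf n y hy x hx).const_mul _)).add
        ((hq x hx y hy).mul_continuousOn ((hcg n y hy x hx).const_mul _))).const_mul z
    exact this.def'.aestronglyMeasurable
  · refine Eventually.of_forall fun t ht => ?_
    have ht' := uIoc_subset_uIcc ht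
    have b1 := sb (fun n => f n t) (fun n => (hM t ht' n).1) n
    have b2 := sb (fun n => g n t) (fun n => (hM t ht' n).2.1) n
    rw [norm_mul]
    gcongr
    refine (norm_add_le _ _).trans ?_
    rw [norm_mul, norm_mul (q t), add_mul]
    gcongr
  · exact Eventually.of_forall fun t ht => (hsb.mul_left _).mul_left _
  · have e2 : (fun t => ∑' n : ℕ, ‖z‖ * ((‖p t‖ + ‖q t‖) * (‖z‖ ^ n * (M * α ^ n / n.factorial))))
      = fun t => ‖z‖ * ((‖p t‖ + ‖q t‖) * (M * Real.exp (α * ‖z‖))) := by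
      ext t; rw [tsum_mul_left, tsum_mul_left, tsum_exp_bound]
    rw [e2]
    exact (((hp x hx y hy).norm.add (hq x hx y hy).norm).mul_const _).const_mul _
  · refine Eventually.of_forall fun t ht => ?_
    have ht' := uIoc_subset_uIcc ht
    exact (((sm (fun n => f n t) fun n => (hM t ht' n).1).hasSum.mul_left (p t)).add
      ((sm (fun n => g n t) fun n => (hM t ht' n).2.1).hasSum.mul_left (q t))).mul_left z

lemma sol_acd {I : Set ℝ} (hI : I.OrdConnected) {k11 k12 k21 k22 : ℝ → ℂ} (h11 : IntOn I k11)
    (h12 : IntOn I k12) (h21 : IntOn I k21) (h22 : IntOn I k22) {c : ℝ} (hc : c ∈ I) (y1 y2 : ℂ)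
    (z : ℂ) :
    ACD I (sol1 k11 k12 k21 k22 c y1 y2 z)
      (fun t => z * (k11 t * sol1 k11 k12 k21 k22 c y1 y2 z t
        + k12 t * sol2 k11 k12 k21 k22 c y1 y2 z t)) ∧
    ACD I (sol2 k11 k12 k21 k22 c y1 y2 z)
      (fun t => z * (k21 t * sol1 k11 k12 k21 k22 c y1 y2 z t
        + k22 t * sol2 k11 k12 k21 k22 c y1 y2 z t)) := by
  have hcont := neu_cont hI h11 h12 h21 h22 hc y1 y2
  have hacd := neu_acd hI h11 h12 h21 h22 hc y1 y2
  have hK := kk_int h11 h12 h21 h22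
  have hb : ∀ x ∈ I, ∀ y ∈ I, ∃ M α : ℝ, ∀ t ∈ uIcc x y, ∀ n : ℕ,
      ‖(neu k11 k12 k21 k22 c y1 y2 n t).1‖ ≤ M * α ^ n / n.factorial ∧
      ‖(neu k11 k12 k21 k22 c y1 y2 n t).2‖ ≤ M * α ^ n / n.factorial := by
    intro x hx y hy
    have hcont : ContinuousOn (fun t => ∫ s in x..t, kk k11 k12 k21 k22 s) (uIcc x y) :=
      ((hK y hy x hx).absolutelyContinuousOnInterval_intervalIntegral left_mem_uIcc).continuousOn
    obtain ⟨B, hB⟩ := isCompact_uIcc.exists_bound_of_continuousOn hcont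
    refine ⟨‖y1‖ + ‖y2‖, |∫ s in c..x, kk k11 k12 k21 k22 s| + B, fun t ht n => ?_⟩
    have htI := ACD.sub_uIcc hI hx hy ht
    have hα : |∫ s in c..t, kk k11 k12 k21 k22 s| ≤ |∫ s in c..x, kk k11 k12 k21 k22 s| + B := by
      rw [← intervalIntegral.integral_add_adjacent_intervals (hK x hx c hc) (hK t htI x hx)]
      refine (abs_add_le _ _).trans ?_
      have := hB t ht
      rw [Real.norm_eq_abs] at this
      gcongr
    obtain ⟨b1, b2⟩ := neu_bound hI h11 h12 h21 h22 hc y1 y2 n t htI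
    exact ⟨b1.trans (by gcongr), b2.trans (by gcongr)⟩
  constructor
  · refine series_acd hI h11 h12 (fun n x hx y hy => (hcont n x hx y hy).1)
      (fun n x hx y hy => (hcont n x hx y hy).2) (fun n => (hacd n).1) (fun _ _ => rfl) ?_ z
    intro x hx y hy
    obtain ⟨M, α, h⟩ := hb x hx y hy
    exact ⟨M, α, fun t ht n => ⟨(h t ht n).1, (h t ht n).2, (h t ht n).1⟩⟩
  · refine series_acd hI h21 h22 (fun n x hx y hy => (hcont n x hx y hy).1)
      (fun n x hx y hy => (hcont n x hx y hy).2) (fun n => (hacd n).2) (fun _ _ => rfl) ?_ z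
    intro x hx y hy
    obtain ⟨M, α, h⟩ := hb x hx y hy
    exact ⟨M, α, fun t ht n => ⟨(h t ht n).1, (h t ht n).2, (h t ht n).2⟩⟩

lemma sol_entire {I : Set ℝ} (hI : I.OrdConnected) {k11 k12 k21 k22 : ℝ → ℂ} (h11 : IntOn I k11)
    (h12 : IntOn I k12) (h21 : IntOn I k21) (h22 : IntOn I k22) {c : ℝ} (hc : c ∈ I) (y1 y2 : ℂ)
    {x : ℝ} (hx : x ∈ I) :
    ∃ M α : ℝ, 
    (Differentiable ℂ (fun z => sol1 k11 k12 k21 k22 c y1 y2 z x) ∧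
      ∀ z, ‖sol1 k11 k12 k21 k22 c y1 y2 z x‖ ≤ M * Real.exp (α * ‖z‖)) ∧
    (Differentiable ℂ (fun z => sol2 k11 k12 k21 k22 c y1 y2 z x) ∧
      ∀ z, ‖sol2 k11 k12 k21 k22 c y1 y2 z x‖ ≤ M * Real.exp (α * ‖z‖)) := by
  have hb := fun n => neu_bound hI h11 h12 h21 h22 hc y1 y2 n x hx
  exact ⟨_, _, entire_of_coef fun n => (hb n).1, entire_of_coef fun n => (hb n).2⟩

/-- Cayley transform of the disc onto the upper half plane -/
def cay (w : ℂ) : ℂ := I * (1 + w) / (1 - w)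

lemma cay_im (w : ℂ) : (cay w).im = (1 - ‖w‖ ^ 2) / normSq (1 - w) := by
  rw [← Complex.normSq_eq_norm_sq]
  unfold cay
  rw [Complex.div_im]
  simp [Complex.normSq_apply]
  ring

lemma cay_cont {h : ℂ → ℝ} (hc : ContinuousOn h {z : ℂ | 0 ≤ z.im}) :
    ContinuousOn (fun w => h (cay w)) {w : ℂ | ‖w‖ ≤ 1 ∧ w ≠ 1} := by
  apply hc.comp
  · unfold cay
    apply ContinuousOn.div (by fun_prop) (by fun_prop)
    intro x hx h0
    exact hx.2 (by linear_combination -h0)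
  · intro w hw
    simp only [mem_ofPred_eq] at hw ⊢
    rw [cay_im]
    apply div_nonneg _ (normSq_nonneg _)
    nlinarith [norm_nonneg w, hw.1]

lemma circle_ne_one {ρ θ : ℝ} (hρ : 0 < ρ) (hθ : θ ∈ Ioo 0 (2 * Real.pi)) :
    circleMap 0 ρ θ ≠ (1:ℂ) := by
  intro h
  have h1 : ‖circleMap 0 ρ θ‖ = 1 := by rw [h]; simp
  have h2 : ρ = 1 := by simpa [abs_of_pos hρ] using h1
  subst h2
  have h3 : Real.cos θ = 1 := by
    have := congrArg Complex.re h
    simpa [circleMap, Complex.exp_re] using this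
  rw [Real.cos_eq_one_iff] at h3
  obtain ⟨n, hn⟩ := h3
  have hp := Real.pi_pos
  have h4 : (0:ℝ) < n := by
    by_contra h5
    push Not at h5
    nlinarith [hθ.1]
  have h5 : (n:ℝ) < 1 := by
    by_contra h5
    push Not at h5
    nlinarith [hθ.2]
  have h6 : (0:ℤ) < n := by exact_mod_cast h4
  have h7 : n < (1:ℤ) := by exact_mod_cast h5
  omega

lemma cay_arctan (t : ℝ) : cay (circleMap 0 1 (Real.pi + 2 * Real.arctan t)) = t := by
  have e : circleMap 0 1 (Real.pi + 2 * Real.arctan t) =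
      - ((Real.cos (Real.arctan t) : ℂ) + Real.sin (Real.arctan t) * I) ^ 2 := by
    simp only [circleMap]
    push_cast
    rw [← Complex.exp_mul_I, ← Complex.exp_nat_mul, add_mul, Complex.exp_add, Complex.exp_pi_mul_I]
    simp; ring_nf
  set c := Real.cos (Real.arctan t) with hc
  have hcpos : 0 < c := Real.cos_arctan_pos t
  have hs : Real.sin (Real.arctan t) = t * c := by
    have := Real.tan_arctan t
    rw [Real.tan_eq_sin_div_cos, div_eq_iff hcpos.ne'] at this
    exact this
  have h1 : c ^ 2 * (1 + t ^ 2) = 1 := by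
    have := Real.sin_sq_add_cos_sq (Real.arctan t)
    rw [hs] at this
    linear_combination this
  have h1c : (c : ℂ) ^ 2 * (1 + t ^ 2) = 1 := by exact_mod_cast h1
  rw [e, hs]
  unfold cay
  have hI : (I:ℂ) ^ 2 = -1 := Complex.I_sq
  have h3 : (1 - -((c:ℂ) + ((t * c : ℝ):ℂ) * I) ^ 2) = 2 * c ^ 2 * (1 + t * I) := by
    push_cast
    linear_combination -h1c + (t^2 * c^2 : ℂ) * hI
  have h4 : (1 + -((c:ℂ) + ((t * c : ℝ):ℂ) * I) ^ 2) = 2 * c ^ 2 * (1 + t * I) * (- I * t) := by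
    push_cast
    linear_combination -h1c + (t^2 * c^2 : ℂ) * hI
  have h5 : (2 * (c:ℂ) ^ 2 * (1 + t * I)) ≠ 0 := by
    apply mul_ne_zero
    · have : (c:ℂ) ≠ 0 := by exact_mod_cast hcpos.ne'
      exact mul_ne_zero two_ne_zero (pow_ne_zero _ this)
    · intro h
      have := congrArg Complex.re h
      simp at this
  rw [h3, h4, div_eq_iff h5]
  linear_combination (- 2 * (c:ℂ) ^ 2 * (1 + t * I) * t) * hI

lemma poisson_int {h : ℂ → ℝ} (h0 : ∀ z, 0 ≤ z.im → 0 ≤ h z)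
    (hc : ContinuousOn h {z : ℂ | 0 ≤ z.im})
    (hh : ∀ w : ℂ, ‖w‖ < 1 → InnerProductSpace.HarmonicAt (fun w => h (cay w)) w) :
    Integrable (fun t : ℝ => h t / (1 + t ^ 2)) := by
  have hcc := cay_cont hc
  set g : ℂ → ℝ := fun w => h (cay w) with hg
  let ρ : ℕ → ℝ := fun n => 1 - 1 / ((n:ℝ) + 2)
  have hρ0 : ∀ n, 0 < ρ n := fun n => by
    have : 1 / ((n:ℝ) + 2) < 1 := by rw [div_lt_one (by positivity)]; linarith [Nat.cast_nonneg (α := ℝ) n]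
    simp only [ρ]; linarith
  have hρ1 : ∀ n, ρ n < 1 := fun n => by
    have : 0 < 1 / ((n:ℝ) + 2) := by positivity
    simp only [ρ]; linarith
  have hρl : Tendsto ρ atTop (𝓝 1) := by
    have h1 : Tendsto (fun n : ℕ => 1 / ((n:ℝ) + 2)) atTop (𝓝 0) := by
      have := (tendsto_const_div_atTop_nhds_zero_nat (1:ℝ)).comp (tendsto_add_atTop_nat 2)
      refine this.congr fun n => ?_
      simp
    simpa [ρ] using (tendsto_const_nhds (x := (1:ℝ))).sub h1
  have hcont : ∀ n, Continuous fun θ => g (circleMap 0 (ρ n) θ) := fun n => by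
    apply hcc.comp_continuous (continuous_circleMap 0 _)
    intro θ
    have : ‖circleMap 0 (ρ n) θ‖ = ρ n := by simp [abs_of_pos (hρ0 n)]
    refine ⟨by rw [this]; exact (hρ1 n).le, fun h1 => ?_⟩
    rw [h1] at this
    simp at this
    linarith [hρ1 n]
  have hnn : ∀ n θ, 0 ≤ g (circleMap 0 (ρ n) θ) := fun n θ => by
    apply h0
    rw [cay_im]
    apply div_nonneg _ (normSq_nonneg _)
    have : ‖circleMap 0 (ρ n) θ‖ = ρ n := by simp [abs_of_pos (hρ0 n)]
    rw [this]
    nlinarith [hρ0 n, hρ1 n]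
  have hav : ∀ n, ∫ θ in (0:ℝ)..(2 * Real.pi), g (circleMap 0 (ρ n) θ) = 2 * Real.pi * g 0 := fun n => by
    have h1 : Real.circleAverage g 0 (ρ n) = g 0 := by
      apply InnerProductSpace.HarmonicOnNhd.circleAverage_eq
      intro w hw
      apply hh
      rw [abs_of_pos (hρ0 n)] at hw
      simp at hw
      linarith [hρ1 n]
    rw [Real.circleAverage_def, smul_eq_mul] at h1
    have := Real.pi_pos
    field_simp at h1
    linarith
  have hint : IntegrableOn (fun θ => g (circleMap 0 1 θ)) (Ioo 0 (2 * Real.pi)) := by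
    apply integrable_of_tendsto (G := fun n θ => g (circleMap 0 (ρ n) θ))
    · refine (ae_restrict_iff' measurableSet_Ioo).2 (Eventually.of_forall fun θ hθ => ?_)
      have hm : circleMap 0 1 θ ∈ {w : ℂ | ‖w‖ ≤ 1 ∧ w ≠ 1} := by
        refine ⟨by simp, circle_ne_one one_pos hθ⟩
      have := hcc _ hm
      apply Tendsto.comp this
      apply tendsto_nhdsWithin_iff.2
      refine ⟨?_, Eventually.of_forall fun n => ⟨?_, circle_ne_one (hρ0 n) hθ⟩⟩
      · have hc2 : Continuous fun x : ℝ => circleMap 0 x θ := by unfold circleMap; fun_prop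
        exact (hc2.tendsto 1).comp hρl
      · simp [abs_of_pos (hρ0 n), (hρ1 n).le]
    · exact fun n => (hcont n).aestronglyMeasurable
    · have : ∀ n, ∫⁻ θ in Ioo 0 (2 * Real.pi), ‖g (circleMap 0 (ρ n) θ)‖ₑ = ENNReal.ofReal (2 * Real.pi * g 0) := by
        intro n
        rw [← hav n, intervalIntegral.integral_of_le (by positivity), integral_Ioc_eq_integral_Ioo,
          ofReal_integral_eq_lintegral_ofReal]
        · apply lintegral_congr
          intro θ
          rw [Real.enorm_eq_ofReal (hnn n θ)]
        · exact ((hcont n).integrableOn_Icc).mono_set Ioo_subset_Icc_self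
        · exact Eventually.of_forall fun θ => hnn n θ
      simp only [this]
      simp
  let f : ℝ → ℝ := fun t => Real.pi + 2 * Real.arctan t
  have hf : ∀ x ∈ (univ : Set ℝ), HasDerivWithinAt f (2 * (1 / (1 + x ^ 2))) univ x := fun x _ =>
    (((Real.hasDerivAt_arctan x).const_mul 2).const_add Real.pi).hasDerivWithinAt
  have hinj : InjOn f univ := fun x _ y _ hxy => by
    have : Real.arctan x = Real.arctan y := by simp only [f] at hxy; linarith
    exact Real.arctan_injective this
  have hsub : f '' univ ⊆ Ioo 0 (2 * Real.pi) := by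
    rintro _ ⟨x, -, rfl⟩
    have h1 := Real.neg_pi_div_two_lt_arctan x
    have h2 := Real.arctan_lt_pi_div_two x
    constructor <;> simp only [f] <;> linarith
  have key := (integrableOn_image_iff_integrableOn_abs_deriv_smul MeasurableSet.univ hf hinj
    (fun θ => g (circleMap 0 1 θ))).1 (hint.mono_set hsub)
  rw [integrableOn_univ] at key
  refine (key.const_mul (1/2)).congr (Eventually.of_forall fun t => ?_)
  simp only [f, hg, cay_arctan, smul_eq_mul]
  rw [abs_of_pos (by positivity)]
  ring

/-- partial factorisation -/
structure Fac (F : ℂ → ℂ) (R : ℝ) (S : Multiset ℂ) (g : ℂ → ℂ) : Prop where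
  diff : Differentiable ℂ g
  mem : ∀ s ∈ S, s ≠ 0 ∧ ‖s‖ ≤ R
  eq : ∀ z, F z = (S.map (fun s => 1 - z / s)).prod * g z

lemma prod_lower {R : ℝ} {z : ℂ} (hz : ‖z‖ = 3 * R) (S : Multiset ℂ)
    (h : ∀ s ∈ S, s ≠ 0 ∧ ‖s‖ ≤ R) : 2 ^ (Multiset.card S) ≤ ‖(S.map (fun s => 1 - z / s)).prod‖ := by
  induction S using Multiset.induction_on with
  | empty => simp
  | cons s S ih =>
    have h1 := ih fun t ht => h t (Multiset.mem_cons_of_mem ht)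
    obtain ⟨h2, h3⟩ := h s (Multiset.mem_cons_self s S)
    have h4 : 2 ≤ ‖1 - z / s‖ := by
      have h5 : 3 ≤ ‖z / s‖ := by
        rw [norm_div, le_div_iff₀ (norm_pos_iff.2 h2), hz]; linarith
      have h6 := norm_sub_norm_le (z / s) 1
      rw [norm_sub_rev] at h6
      simp only [norm_one] at h6
      linarith
    simp only [Multiset.map_cons, Multiset.prod_cons, Multiset.card_cons, norm_mul]
    rw [pow_succ, mul_comm]
    exact mul_le_mul h4 h1 (by positivity) (by positivity)

lemma prod_zero (S : Multiset ℂ) : (S.map (fun s => 1 - (0:ℂ) / s)).prod = 1 := by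
  simp

lemma Fac.bound {F : ℂ → ℂ} {R : ℝ} (hR : 0 < R) {S : Multiset ℂ} {g : ℂ → ℂ} (h : Fac F R S g)
    {C τ : ℝ} (hF : ∀ z, ‖F z‖ ≤ C * Real.exp (τ * ‖z‖)) {z : ℂ} (hz : ‖z‖ ≤ 3 * R) :
    ‖g z‖ ≤ C * Real.exp (3 * τ * R) / 2 ^ (Multiset.card S) := by
  have hb : Bornology.IsBounded (Metric.ball (0:ℂ) (3 * R)) := Metric.isBounded_ball
  apply Complex.norm_le_of_forall_mem_frontier_norm_le hb (f := g) h.diff.diffContOnCl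
  · intro w hw
    rw [frontier_ball _ (by positivity)] at hw
    have hw : ‖w‖ = 3 * R := by simpa using hw
    have h1 := prod_lower hw S h.mem
    have h2 := hF w
    rw [h.eq w, norm_mul, hw] at h2
    rw [le_div_iff₀ (by positivity)]
    calc ‖g w‖ * 2 ^ (Multiset.card S) ≤ ‖g w‖ * _ := by gcongr
      _ = _ * ‖g w‖ := mul_comm _ _
      _ ≤ _ := h2
      _ = _ := by ring_nf
  · rw [closure_ball _ (by positivity)]
    simpa using hz

lemma Fac.step {F : ℂ → ℂ} (hF0 : F 0 ≠ 0) {R : ℝ} {S : Multiset ℂ} {g : ℂ → ℂ} (h : Fac F R S g)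
    {z0 : ℂ} (hz : ‖z0‖ ≤ R) (h0 : g z0 = 0) : ∃ g', Fac F R (z0 ::ₘ S) g' := by
  have hz0 : z0 ≠ 0 := by
    rintro rfl
    apply hF0
    rw [h.eq, h0, mul_zero]
  refine ⟨fun z => - z0 * dslope g z0 z, ?_, ?_, ?_⟩
  · have : DifferentiableOn ℂ (dslope g z0) univ :=
      (Complex.differentiableOn_dslope univ_mem).2 h.diff.differentiableOn
    exact (differentiableOn_univ.1 this).const_mul _
  · intro s hs
    rcases Multiset.mem_cons.1 hs with rfl | hs
    · exact ⟨hz0, hz⟩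
    · exact h.mem s hs
  · intro z
    rw [h.eq z]
    have h1 : g z = (z - z0) * dslope g z0 z := by
      have := sub_smul_dslope g z0 z
      rw [h0, sub_zero, smul_eq_mul] at this
      exact this.symm
    simp only [Multiset.map_cons, Multiset.prod_cons]
    rw [h1]
    field_simp
    ring

lemma exists_fac {F : ℂ → ℂ} (hd : Differentiable ℂ F) (hF0 : F 0 ≠ 0) {R : ℝ} (hR : 0 < R)
    {C τ : ℝ} (hF : ∀ z, ‖F z‖ ≤ C * Real.exp (τ * ‖z‖)) :
    ∃ S g, Fac F R S g ∧ ∀ z, ‖z‖ ≤ R → g z ≠ 0 := by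
  by_contra hcon
  push Not at hcon
  have hall : ∀ n : ℕ, ∃ S g, Fac F R S g ∧ Multiset.card S = n := by
    intro n
    induction n with
    | zero => exact ⟨0, F, ⟨hd, by simp, by simp⟩, rfl⟩
    | succ n ih =>
      obtain ⟨S, g, hf, hn⟩ := ih
      obtain ⟨z0, h1, h2⟩ := hcon S g hf
      obtain ⟨g', hg'⟩ := hf.step hF0 h1 h2
      exact ⟨_, g', hg', by simp [hn]⟩
  have hpos : 0 < ‖F 0‖ := norm_pos_iff.2 hF0
  obtain ⟨n, hn⟩ := pow_unbounded_of_one_lt (C * Real.exp (3 * τ * R) / ‖F 0‖) (one_lt_two (α := ℝ))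
  obtain ⟨S, g, hf, hc⟩ := hall n
  have h1 := hf.bound hR hF (z := 0) (by simp; positivity)
  have h2 := hf.eq 0
  rw [prod_zero, one_mul] at h2
  rw [← h2, hc, le_div_iff₀ (by positivity)] at h1
  rw [div_lt_iff₀ hpos] at hn
  linarith

lemma Fac.zero_mem {F : ℂ → ℂ} {R : ℝ} {S : Multiset ℂ} {g : ℂ → ℂ} (h : Fac F R S g)
    {z : ℂ} (hg : g z ≠ 0) (hz : F z = 0) : z ∈ S := by
  rw [h.eq z] at hz
  rcases mul_eq_zero.1 hz with h1 | h1
  · rw [Multiset.prod_eq_zero_iff] at h1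
    obtain ⟨s, hs, h2⟩ := Multiset.mem_map.1 h1
    have h3 := (h.mem s hs).1
    have : z = s := by field_simp at h2; linear_combination -h2
    rwa [this]
  · exact absurd h1 hg

lemma Fac.mem_zero {F : ℂ → ℂ} {R : ℝ} {S : Multiset ℂ} {g : ℂ → ℂ} (h : Fac F R S g)
    {z : ℂ} (hz : z ∈ S) : F z = 0 := by
  rw [h.eq z]
  have h3 := (h.mem z hz).1
  have : (S.map (fun s => 1 - z / s)).prod = 0 := by
    rw [Multiset.prod_eq_zero_iff]
    exact Multiset.mem_map.2 ⟨z, hz, by field_simp; simp⟩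
  rw [this, zero_mul]

lemma zero_count {F : ℂ → ℂ} (hd : Differentiable ℂ F) (hF0 : F 0 ≠ 0)
    {C τ : ℝ} (hF : ∀ z, ‖F z‖ ≤ C * Real.exp (τ * ‖z‖)) :
    ∃ K : ℝ, ∀ R : ℝ, 1 ≤ R → ∀ T : Finset ℂ, (∀ z ∈ T, ‖z‖ ≤ R ∧ F z = 0) → (T.card : ℝ) ≤ K * R := by
  have hpos : 0 < ‖F 0‖ := norm_pos_iff.2 hF0
  have hC : 0 < C := by
    have := hF 0
    simp at this
    linarith
  refine ⟨(|Real.log (C / ‖F 0‖)| + 3 * |τ|) / Real.log 2, fun R hR T hT => ?_⟩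
  obtain ⟨S, g, hf, hg⟩ := exists_fac hd hF0 (by linarith : 0 < R) hF
  have h1 : T.card ≤ Multiset.card S := by
    calc T.card ≤ S.toFinset.card := Finset.card_le_card fun z hz => by
            rw [Multiset.mem_toFinset]
            exact hf.zero_mem (hg z (hT z hz).1) (hT z hz).2
      _ ≤ _ := Multiset.toFinset_card_le S
  have h3 := hf.bound (by linarith) hF (z := 0) (by simp; linarith)
  have h2 := hf.eq 0
  rw [prod_zero, one_mul] at h2
  rw [← h2, le_div_iff₀ (by positivity)] at h3
  have h4 : (2:ℝ) ^ (Multiset.card S) ≤ C / ‖F 0‖ * Real.exp (3 * τ * R) := by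
    rw [div_mul_eq_mul_div, le_div_iff₀ hpos]
    linarith
  have h5 := Real.log_le_log (by positivity) h4
  rw [Real.log_pow, Real.log_mul (by positivity) (by positivity), Real.log_exp] at h5
  have h6 := Real.log_pos (one_lt_two (α := ℝ))
  rw [div_mul_eq_mul_div, le_div_iff₀ h6]
  have h7 : (T.card : ℝ) ≤ (Multiset.card S : ℝ) := by exact_mod_cast h1
  have h8 := le_abs_self (Real.log (C / ‖F 0‖))
  have h9 := le_abs_self τ
  have h10 := abs_nonneg (Real.log (C / ‖F 0‖))
  nlinarith

lemma prod_deriv (S : Multiset ℂ) :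
    HasDerivAt (fun z : ℂ => (S.map (fun s => 1 - z / s)).prod) (-(S.map (fun s => 1 / s)).sum) 0 := by
  induction S using Multiset.induction_on with
  | empty => simpa using hasDerivAt_const (0:ℂ) (1:ℂ)
  | cons s S ih =>
    have h1 : HasDerivAt (fun z : ℂ => 1 - z / s) (-(1 / s)) 0 :=
      ((hasDerivAt_id (0:ℂ)).div_const s).const_sub 1
    have h2 := h1.mul ih
    simp only [Multiset.map_cons, Multiset.prod_cons, Multiset.sum_cons]
    refine h2.congr_deriv ?_
    rw [prod_zero]
    simp
    ring

lemma log_deriv_bound {g : ℂ → ℂ} (hd : Differentiable ℂ g) {R B : ℝ} (hR : 0 < R)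
    (hg : ∀ z, ‖z‖ ≤ R → g z ≠ 0) (hB : 0 < B) (hb : ∀ z, ‖z‖ ≤ R → ‖g z‖ ≤ ‖g 0‖ * Real.exp B) :
    ‖deriv g 0 / g 0‖ ≤ 4 * B / R := by
  have hdl : DifferentiableOn ℂ (fun z => deriv g z / g z) (Metric.ball 0 R) := by
    apply DifferentiableOn.div
    · exact (hd.contDiff (n := 2)).differentiable_deriv_two.differentiableOn
    · exact hd.differentiableOn
    · intro z hz
      apply hg
      simpa using (Metric.mem_ball.1 hz).le
  obtain ⟨L, hL0, hL⟩ := hdl.isExactOn_ball.with_val_at 0 0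
  have hg0 := hg 0 (by simp; linarith)
  have hexp : ∀ z ∈ Metric.ball (0:ℂ) R, g z * Complex.exp (- L z) = g 0 := by
    intro z hz
    have h1 : ∀ w ∈ Metric.ball (0:ℂ) R, HasDerivAt (fun z => g z * Complex.exp (- L z)) 0 w := by
      intro w hw
      have h2 := ((hd w).hasDerivAt).mul ((hL w hw).neg.cexp)
      refine h2.congr_deriv ?_
      have := hg w (by simpa using (Metric.mem_ball.1 hw).le)
      field_simp
      ring
    have h2 := (Metric.isOpen_ball (x := (0:ℂ)) (ε := R)).is_const_of_deriv_eq_zero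
      (convex_ball (0:ℂ) R).isPreconnected
      (fun w hw => (h1 w hw).differentiableAt.differentiableWithinAt)
      (fun w hw => (h1 w hw).deriv) hz (Metric.mem_ball_self hR)
    rw [h2, hL0]; simp
  have hre : MapsTo L (Metric.ball 0 R) {z | z.re ≤ B} := by
    intro z hz
    have h1 := hb z (by simpa using (Metric.mem_ball.1 hz).le)
    have h2 : g z = g 0 * Complex.exp (L z) := by
      rw [← hexp z hz, mul_assoc, ← Complex.exp_add]; simp
    rw [h2, norm_mul, Complex.norm_exp] at h1
    have h3 := le_of_mul_le_mul_left h1 (norm_pos_iff.2 hg0)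
    exact Real.exp_le_exp.1 h3
  have hLd : DifferentiableOn ℂ L (Metric.ball 0 R) := fun w hw =>
    (hL w hw).differentiableAt.differentiableWithinAt
  have hLb : ∀ z ∈ Metric.sphere (0:ℂ) (R / 2), ‖L z‖ ≤ 2 * B := by
    intro z hz
    have hz' : ‖z‖ = R / 2 := by simpa using hz
    have h1 := Complex.borelCaratheodory_zero hB hLd hre hR (z := z) (by simp; linarith) hL0
    rw [hz'] at h1
    have : 2 * B * (R / 2) / (R - R / 2) = 2 * B := by field_simp; ring
    linarith
  have h2 := Complex.norm_deriv_le_of_forall_mem_sphere_norm_le (c := (0:ℂ)) (R := R / 2) (f := L) (C := 2 * B)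
    (by positivity) ((hLd.mono (Metric.closedBall_subset_ball (by linarith))).diffContOnCl_ball subset_rfl) hLb
  rw [(hL 0 (Metric.mem_ball_self hR)).deriv] at h2
  refine h2.trans (le_of_eq ?_)
  field_simp
  ring

lemma recip_sum {F : ℂ → ℂ} (hd : Differentiable ℂ F) (hF0 : F 0 ≠ 0)
    {C τ : ℝ} (hF : ∀ z, ‖F z‖ ≤ C * Real.exp (τ * ‖z‖))
    (hz : ∀ z, F z = 0 → z.im = 0 ∧ 1 ≤ z.re) :
    ∃ B : ℝ, ∀ T : Finset ℝ, (∀ t ∈ T, F t = 0) → ∑ t ∈ T, t⁻¹ ≤ B := by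
  have hpos : 0 < ‖F 0‖ := norm_pos_iff.2 hF0
  have hC : 0 < C := by
    have := hF 0
    simp at this
    linarith
  refine ⟨4 * (|Real.log (C / ‖F 0‖)| + 3 * |τ| + 1) + ‖deriv F 0 / F 0‖, fun T hT => ?_⟩
  set R : ℝ := 1 + ∑ t ∈ T, |t| with hRdef
  have hRs : 0 ≤ ∑ t ∈ T, |t| := Finset.sum_nonneg fun _ _ => abs_nonneg _
  have hR1 : 1 ≤ R := by linarith
  have hR : 0 < R := by linarith
  obtain ⟨S, g, hf, hg⟩ := exists_fac hd hF0 hR hF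
  have hF0g : F 0 = g 0 := by
    have h2 := hf.eq 0
    rwa [prod_zero, one_mul] at h2
  set B : ℝ := (|Real.log (C / ‖F 0‖)| + 3 * |τ| + 1) * R with hB
  have hBpos : 0 < B := by positivity
  have hbound : ∀ z, ‖z‖ ≤ R → ‖g z‖ ≤ ‖g 0‖ * Real.exp B := by
    intro z hz
    have h1 := hf.bound hR hF (z := z) (by linarith)
    have h2 : C * Real.exp (3 * τ * R) / 2 ^ (Multiset.card S) ≤ C * Real.exp (3 * τ * R) :=
      div_le_self (by positivity) (one_le_pow₀ one_le_two)
    have h3 : C * Real.exp (3 * τ * R) = ‖g 0‖ * Real.exp (Real.log (C / ‖F 0‖) + 3 * τ * R) := by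
      rw [Real.exp_add, Real.exp_log (by positivity), ← hF0g]
      field_simp
    have h4 : Real.log (C / ‖F 0‖) + 3 * τ * R ≤ B := by
      have h8 := le_abs_self (Real.log (C / ‖F 0‖))
      have h9 := le_abs_self τ
      have h10 := abs_nonneg (Real.log (C / ‖F 0‖))
      nlinarith
    have h5 : ‖g 0‖ * Real.exp (Real.log (C / ‖F 0‖) + 3 * τ * R) ≤ ‖g 0‖ * Real.exp B := by gcongr
    linarith
  have h1 := log_deriv_bound hf.diff hR hg hBpos hbound
  have h2 : 4 * B / R = 4 * (|Real.log (C / ‖F 0‖)| + 3 * |τ| + 1) := by rw [hB]; field_simp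
  rw [h2] at h1
  have h3 : deriv F 0 = -(S.map (fun s => 1 / s)).sum * g 0 + deriv g 0 := by
    have h4 := (prod_deriv S).mul ((hf.diff 0).hasDerivAt)
    rw [prod_zero, one_mul] at h4
    have h5 : F = (fun z : ℂ => (S.map (fun s => 1 - z / s)).prod) * g := funext hf.eq
    rw [← h5] at h4
    exact h4.deriv
  have hg0 : g 0 ≠ 0 := hF0g ▸ hF0
  have h4 : (S.map (fun s => 1 / s)).sum = deriv g 0 / g 0 - deriv F 0 / F 0 := by
    rw [h3, hF0g]; field_simp; ring
  have h5 : ‖(S.map (fun s => 1 / s)).sum‖ ≤ 4 * (|Real.log (C / ‖F 0‖)| + 3 * |τ| + 1) + ‖deriv F 0 / F 0‖ := by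
    rw [h4]; exact (norm_sub_le _ _).trans (by linarith)
  refine le_trans ?_ ((Complex.re_le_norm _).trans h5)
  have h6 : ((S.map (fun s => 1 / s)).sum).re = (S.map (fun s => (1 / s : ℂ).re)).sum := by
    have := map_multiset_sum Complex.reAddGroupHom (S.map (fun s => 1 / s))
    simpa [Multiset.map_map, Function.comp_def] using this
  have h7 : (T.map ⟨((↑) : ℝ → ℂ), Complex.ofReal_injective⟩).val ≤ S := by
    rw [Finset.val_le_iff_val_subset]
    intro z hz'
    have hz'' : z ∈ T.map ⟨((↑) : ℝ → ℂ), Complex.ofReal_injective⟩ := hz'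
    obtain ⟨t, ht, rfl⟩ := Finset.mem_map.1 hz''
    apply hf.zero_mem (hg _ _) (hT t ht)
    simp only [Function.Embedding.coeFn_mk, Complex.norm_real, Real.norm_eq_abs]
    have := Finset.single_le_sum (f := fun t : ℝ => |t|) (fun _ _ => abs_nonneg _) ht
    linarith
  obtain ⟨U, hU⟩ := Multiset.le_iff_exists_add.1 h7
  have h8 : (S.map (fun s => (1 / s : ℂ).re)).sum = ∑ t ∈ T, t⁻¹ + (U.map (fun s => (1 / s : ℂ).re)).sum := by
    rw [hU, Multiset.map_add, Multiset.sum_add]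
    congr 1
    change ∑ z ∈ T.map ⟨((↑) : ℝ → ℂ), Complex.ofReal_injective⟩, (1 / z : ℂ).re = _
    rw [Finset.sum_map]
    apply Finset.sum_congr rfl
    intro t _
    simp only [Function.Embedding.coeFn_mk, one_div]
    rw [← Complex.ofReal_inv, Complex.ofReal_re]
  have h9 : 0 ≤ (U.map (fun s => (1 / s : ℂ).re)).sum := by
    apply Multiset.sum_nonneg
    intro x hx
    obtain ⟨s, hs, rfl⟩ := Multiset.mem_map.1 hx
    have hsS : s ∈ S := by rw [hU]; exact Multiset.mem_add.2 (Or.inr hs)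
    obtain ⟨h10, h11⟩ := hz s (hf.mem_zero hsS)
    rw [one_div, Complex.inv_re]
    exact div_nonneg (by linarith) (normSq_nonneg _)
  rw [h6, h8]
  linarith

lemma summable_of_count {Z : Set ℝ} {K : ℝ}
    (hK : ∀ R : ℝ, 1 ≤ R → ∀ T : Finset ℝ, (∀ t ∈ T, |t| ≤ R ∧ t ∈ Z) → (T.card : ℝ) ≤ K * R)
    {ω : ℝ} (hω : 1 < ω) : Summable fun t : Z => (1 + |(t : ℝ)| ^ ω)⁻¹ := by
  have hK0 : 0 ≤ K := by simpa using hK 1 le_rfl ∅ (by simp)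
  have hex : ∀ t : ℝ, ∃ n : ℕ, |t| ≤ 2 ^ n := fun t => by
    obtain ⟨n, hn⟩ := pow_unbounded_of_one_lt |t| (one_lt_two (α := ℝ))
    exact ⟨n, hn.le⟩
  classical
  let ν : ℝ → ℕ := fun t => Nat.find (hex t)
  have hν : ∀ t, |t| ≤ 2 ^ ν t := fun t => Nat.find_spec (hex t)
  set x : ℝ := (2:ℝ) ^ (-ω) with hx
  have hxpos : 0 < x := by positivity
  have h2ω : (0:ℝ) < 2 ^ ω := by positivity
  have hx1 : x * 2 ^ ω = 1 := by rw [hx, ← Real.rpow_add two_pos]; simp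
  have hterm : ∀ t : ℝ, (1 + |t| ^ ω)⁻¹ ≤ 2 ^ ω * x ^ ν t := by
    intro t
    have ht0 : 0 ≤ |t| ^ ω := by positivity
    rcases hn : ν t with _ | n
    · rw [pow_zero, mul_one]
      have h1 : (1:ℝ) ≤ 2 ^ ω := Real.one_le_rpow one_le_two (by linarith)
      exact (inv_le_one_of_one_le₀ (by linarith)).trans h1
    · have h1 : ¬ |t| ≤ 2 ^ n := Nat.find_min (hex t) (by change n < ν t; omega)
      push Not at h1
      have h2 : ((2:ℝ) ^ ω) ^ n ≤ |t| ^ ω := by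
        rw [← Real.rpow_natCast, ← Real.rpow_mul (by norm_num), mul_comm, Real.rpow_mul (by norm_num),
          Real.rpow_natCast]
        exact Real.rpow_le_rpow (by positivity) h1.le (by linarith)
      have h3 : 2 ^ ω * x ^ (n + 1) = (((2:ℝ) ^ ω) ^ n)⁻¹ := by
        have : x = ((2:ℝ) ^ ω)⁻¹ := eq_inv_of_mul_eq_one_left hx1
        rw [this, inv_pow, pow_succ]
        field_simp
      rw [h3]
      exact inv_anti₀ (by positivity) (by linarith)
  have hgeo : Summable fun n : ℕ => (2 * x) ^ n := by
    apply summable_geometric_of_lt_one (by positivity)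
    have h3 : x < 2 ^ (-1 : ℝ) := Real.rpow_lt_rpow_of_exponent_lt one_lt_two (by linarith)
    rw [Real.rpow_neg_one] at h3
    linarith
  apply summable_of_sum_le (c := K * 2 ^ ω * ∑' n : ℕ, (2 * x) ^ n)
  · intro t; positivity
  · intro T
    have h1 : ∑ t ∈ T, (1 + |(t : ℝ)| ^ ω)⁻¹ = ∑ t ∈ T.map (Function.Embedding.subtype _), (1 + |(t : ℝ)| ^ ω)⁻¹ := by
      rw [Finset.sum_map]; rfl
    rw [h1]
    set T' := T.map (Function.Embedding.subtype _) with hT'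
    have hT'Z : ∀ t ∈ T', t ∈ Z := by
      intro t ht
      obtain ⟨s, _, rfl⟩ := Finset.mem_map.1 ht
      exact s.2
    set N := T'.image ν
    calc ∑ t ∈ T', (1 + |t| ^ ω)⁻¹ ≤ ∑ t ∈ T', 2 ^ ω * x ^ ν t := Finset.sum_le_sum fun t _ => hterm t
      _ = ∑ n ∈ N, ∑ t ∈ T' with ν t = n, 2 ^ ω * x ^ ν t :=
          (Finset.sum_fiberwise_of_maps_to (fun t ht => Finset.mem_image_of_mem ν ht) _).symm
      _ ≤ ∑ n ∈ N, K * 2 ^ ω * (2 * x) ^ n := by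
          apply Finset.sum_le_sum
          intro n _
          have h2 : ∑ t ∈ T' with ν t = n, 2 ^ ω * x ^ ν t = ((T'.filter fun t => ν t = n).card : ℝ) * (2 ^ ω * x ^ n) := by
            rw [Finset.sum_congr rfl (g := fun _ => 2 ^ ω * x ^ n), Finset.sum_const, nsmul_eq_mul]
            intro t ht
            rw [(Finset.mem_filter.1 ht).2]
          rw [h2]
          have h3 := hK (2 ^ n) (one_le_pow₀ one_le_two) (T'.filter fun t => ν t = n) (by
            intro t ht
            obtain ⟨h4, h5⟩ := Finset.mem_filter.1 ht
            exact ⟨h5 ▸ hν t, hT'Z t h4⟩)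
          calc _ ≤ K * 2 ^ n * (2 ^ ω * x ^ n) := by gcongr
            _ = _ := by rw [mul_pow]; ring
      _ = K * 2 ^ ω * ∑ n ∈ N, (2 * x) ^ n := by rw [Finset.mul_sum]
      _ ≤ _ := by
          gcongr
          exact hgeo.sum_le_tsum N (fun _ _ => by positivity)

lemma shift_bound {G : ℂ → ℂ} {C τ : ℝ} (hG : ∀ z, ‖G z‖ ≤ C * Real.exp (τ * ‖z‖)) (e w : ℂ) (he : ‖e‖ = 1) :
    ∃ C' : ℝ, ∀ z, ‖G (e * z + w)‖ ≤ C' * Real.exp (|τ| * ‖z‖) := by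
  refine ⟨|C| * Real.exp (|τ| * ‖w‖), fun z => ?_⟩
  refine (hG _).trans ?_
  rw [mul_assoc, ← Real.exp_add]
  have h1 : ‖e * z + w‖ ≤ ‖z‖ + ‖w‖ := (norm_add_le _ _).trans (by rw [norm_mul, he, one_mul])
  have h2 : τ * ‖e * z + w‖ ≤ |τ| * ‖w‖ + |τ| * ‖z‖ := by
    calc τ * ‖e * z + w‖ ≤ |τ| * ‖e * z + w‖ := by gcongr; exact le_abs_self _
      _ ≤ |τ| * (‖z‖ + ‖w‖) := by gcongr
      _ = _ := by ring
  calc C * Real.exp (τ * ‖e * z + w‖) ≤ |C| * Real.exp (τ * ‖e * z + w‖) := by gcongr; exact le_abs_self _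
    _ ≤ _ := by gcongr

lemma zeros_summable {G : ℂ → ℂ} (hd : Differentiable ℂ G)
    {C τ : ℝ} (hG : ∀ z, ‖G z‖ ≤ C * Real.exp (τ * ‖z‖)) (hI : G I ≠ 0) {Z : Set ℝ}
    (hZ : ∀ t ∈ Z, G t = 0) {ω : ℝ} (hω : 1 < ω) : Summable fun t : Z => (1 + |(t : ℝ)| ^ ω)⁻¹ := by
  obtain ⟨C', hC'⟩ := shift_bound hG 1 I (by simp)
  obtain ⟨K, hK⟩ := zero_count (F := fun z => G (1 * z + I)) (by fun_prop) (by simpa using hI) hC'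
  apply summable_of_count (K := K * 2) _ hω
  intro R hR T hT
  have hinj : Function.Injective (fun t : ℝ => (t:ℂ) - I) := fun s t h => by simpa using h
  have h1 := hK (R + 1) (by linarith) (T.map ⟨fun t : ℝ => (t:ℂ) - I, hinj⟩) (by
    intro z hz
    obtain ⟨t, ht, rfl⟩ := Finset.mem_map.1 hz
    obtain ⟨h2, h3⟩ := hT t ht
    change ‖(t:ℂ) - I‖ ≤ R + 1 ∧ G (1 * ((t:ℂ) - I) + I) = 0
    refine ⟨?_, by simpa using hZ t h3⟩
    refine (norm_sub_le _ _).trans ?_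
    simp
    linarith)
  rw [Finset.card_map] at h1
  have hK0 : 0 ≤ K := by simpa using hK 1 le_rfl ∅ (by simp)
  nlinarith

lemma zeros_semibdd {G : ℂ → ℂ} (hd : Differentiable ℂ G)
    {C τ : ℝ} (hG : ∀ z, ‖G z‖ ≤ C * Real.exp (τ * ‖z‖)) (hre : ∀ z, G z = 0 → z.im = 0) {e m : ℝ}
    (he : e = 1 ∨ e = -1) {Z : Set ℝ}
    (hZ : ∀ t : ℝ, t ∈ Z ↔ G t = 0) (hm : ∀ t ∈ Z, m ≤ e * t) :
    Summable fun t : Z => (1 + |(t : ℝ)|)⁻¹ := by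
  have hee : e * e = 1 := by rcases he with rfl | rfl <;> norm_num
  have heec : (e:ℂ) * e = 1 := by exact_mod_cast hee
  have hen : ‖(e:ℂ)‖ = 1 := by rcases he with rfl | rfl <;> simp
  have hea : |e| = 1 := by rcases he with rfl | rfl <;> simp
  obtain ⟨C', hC'⟩ := shift_bound hG e (e * (m - 1)) hen
  have hz : ∀ z : ℂ, G (e * z + e * (m - 1)) = 0 → z.im = 0 ∧ 1 ≤ z.re := by
    intro z hz
    have h1 := hre _ hz
    have h2 : z.im = 0 := by
      have h3 : e * z.im = 0 := by simpa using h1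
      rcases he with rfl | rfl <;> simpa using h3
    refine ⟨h2, ?_⟩
    have h3 : (e:ℂ) * z + e * (m - 1) = ((e * (z.re + (m - 1)) : ℝ) : ℂ) := by
      apply Complex.ext <;> simp [h2]
      ring
    rw [h3] at hz
    have h4 := hm _ ((hZ _).2 hz)
    rw [← mul_assoc, hee] at h4
    linarith
  obtain ⟨B, hB⟩ := recip_sum (F := fun z => G (e * z + e * (m - 1))) (by fun_prop)
    (by intro h0; have := (hz 0 h0).2; simp at this; linarith) hC' hz
  apply summable_of_sum_le (c := (|m| + 2) * B)
  · intro t; positivity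
  · intro T
    have hinj : Function.Injective (fun t : Z => e * (t:ℝ) - (m - 1)) := fun s t h => by
      apply Subtype.ext
      have h5 : e * (s:ℝ) = e * t := by
        have h6 : e * (s:ℝ) - (m - 1) = e * (t:ℝ) - (m - 1) := h
        linarith
      rcases he with rfl | rfl <;> linarith
    have h1 := hB (T.map ⟨fun t : Z => e * (t:ℝ) - (m - 1), hinj⟩) (by
      intro x hx
      obtain ⟨t, ht, rfl⟩ := Finset.mem_map.1 hx
      have h3 := (hZ _).1 t.2
      change G (e * ((e * (t:ℝ) - (m - 1) : ℝ) : ℂ) + e * (m - 1)) = 0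
      rw [← h3]
      congr 1
      push_cast
      linear_combination (t:ℂ) * heec)
    rw [Finset.sum_map] at h1
    refine le_trans ?_ (mul_le_mul_of_nonneg_left h1 (by positivity))
    rw [Finset.mul_sum]
    apply Finset.sum_le_sum
    intro t _
    have h2 := hm t t.2
    change _ ≤ (|m| + 2) * (e * (t:ℝ) - (m - 1))⁻¹
    have h3 : e * (t:ℝ) ≤ |(t:ℝ)| := by
      have := le_abs_self (e * (t:ℝ))
      rwa [abs_mul, hea, one_mul] at this
    have h4 : 0 < e * (t:ℝ) - (m - 1) := by linarith
    rw [← div_eq_mul_inv, inv_eq_one_div, div_le_div_iff₀ (by positivity) h4]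
    have h5 := neg_abs_le m
    nlinarith [abs_nonneg m, abs_nonneg (t:ℝ)]

lemma log_int {E F G : ℂ → ℂ} (hE : Differentiable ℂ E) (hF : Differentiable ℂ F) (hG : Differentiable ℂ G)
    (hE0 : ∀ z : ℂ, 0 ≤ z.im → E z ≠ 0) (him : ∀ z : ℂ, 0 ≤ z.im → 1 / ‖E z‖ ^ 2 ≤ (F z / E z).im)
    {k : ℝ} (hk : ∀ t : ℝ, ‖G t‖ ≤ k * ‖E t‖) :
    Integrable (fun t : ℝ => Real.log (max 1 ‖G (t : ℂ)‖) / (1 + t ^ 2)) := by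
  set h : ℂ → ℝ := fun z => 2 * Real.log ‖E z‖ + (F z / E z).im with hh
  have hlow : ∀ z : ℂ, 0 ≤ z.im → 1 ≤ h z := by
    intro z hz
    have h1 : 0 < ‖E z‖ := norm_pos_iff.2 (hE0 z hz)
    have h2 := Real.one_sub_inv_le_log_of_pos (x := ‖E z‖ ^ 2) (by positivity)
    rw [Real.log_pow] at h2
    have h3 := him z hz
    rw [one_div] at h3
    push_cast at h2
    simp only [hh]
    linarith
  have hint : Integrable (fun t : ℝ => h t / (1 + t ^ 2)) := by
    apply poisson_int (fun z hz => zero_le_one.trans (hlow z hz))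
    · simp only [hh]
      apply ContinuousOn.add
      · apply ContinuousOn.mul continuousOn_const
        apply ContinuousOn.log
        · exact hE.continuous.norm.continuousOn
        · intro z hz
          exact norm_ne_zero_iff.2 (hE0 z hz)
      · apply Complex.continuous_im.comp_continuousOn
        exact hF.continuous.continuousOn.div hE.continuous.continuousOn fun z hz => hE0 z hz
    · intro w hw
      have hw1 : (1 - w) ≠ 0 := by
        intro h1
        have : w = 1 := by linear_combination -h1
        rw [this] at hw; simp at hw
      have hcay : AnalyticAt ℂ cay w := by
        unfold cay
        fun_prop (disch := assumption)
      have him0 : 0 ≤ (cay w).im := by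
        rw [cay_im]
        apply div_nonneg _ (normSq_nonneg _)
        nlinarith [norm_nonneg w]
      have hEa : AnalyticAt ℂ (fun w => E (cay w)) w := (hE.analyticAt (cay w)).comp hcay
      have hFa : AnalyticAt ℂ (fun w => F (cay w)) w := (hF.analyticAt (cay w)).comp hcay
      have h1 := hEa.harmonicAt_log_norm (hE0 _ him0)
      have h2 := (hFa.div hEa (hE0 _ him0)).harmonicAt_im
      exact (h1.const_smul (c := (2:ℝ))).add h2
  have hc : Continuous fun t : ℝ => Real.log (max 1 ‖G (t : ℂ)‖) / (1 + t ^ 2) := by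
    apply Continuous.div
    · apply Continuous.log
      · exact continuous_const.max (hG.continuous.comp Complex.continuous_ofReal).norm
      · intro t
        have : (1:ℝ) ≤ max 1 ‖G (t : ℂ)‖ := le_max_left _ _
        linarith
    · fun_prop
    · intro t; positivity
  refine Integrable.mono' ((integrable_inv_one_add_sq.const_mul (Real.log (max 1 k))).add (hint.const_mul (1/2)))
    hc.aestronglyMeasurable (Eventually.of_forall fun t => ?_)
  have h0 : 0 ≤ Real.log (max 1 ‖G (t : ℂ)‖) := Real.log_nonneg (le_max_left _ _)
  rw [Real.norm_of_nonneg (by positivity)]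
  have h1 : Real.log (max 1 ‖G (t : ℂ)‖) ≤ Real.log (max 1 k) + 1 / 2 * h t := by
    have hEp : 0 < ‖E t‖ := norm_pos_iff.2 (hE0 t (by simp))
    have h2 : max 1 ‖G (t : ℂ)‖ ≤ max 1 k * max 1 ‖E t‖ := by
      apply max_le
      · nlinarith [le_max_left 1 k, le_max_left 1 ‖E t‖]
      · refine (hk t).trans ?_
        exact mul_le_mul (le_max_right _ _) (le_max_right _ _) hEp.le (by positivity)
    have h3 := Real.log_le_log (by positivity) h2
    rw [Real.log_mul (by positivity) (by positivity)] at h3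
    have h4 : Real.log (max 1 ‖E t‖) ≤ 1 / 2 * h t := by
      rcases le_total ‖E t‖ 1 with h5 | h5
      · rw [max_eq_left h5, Real.log_one]
        have := hlow t (by simp)
        linarith
      · rw [max_eq_right h5]
        have h6 := him t (by simp)
        have : 0 ≤ 1 / ‖E t‖ ^ 2 := by positivity
        simp only [hh]
        linarith
    linarith
  calc _ ≤ (Real.log (max 1 k) + 1 / 2 * h t) / (1 + t ^ 2) := by gcongr
    _ = _ := by simp only [Pi.add_apply]; ring

/-- hypotheses on the canonical system -/
structure CanHyp (a b : ℝ) (r t1 t2 : ℝ → ℝ) : Prop where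
  lt : a < b
  i12 : IntOn (Icc a b) (fun t => ((r t * t1 t * t2 t : ℝ) : ℂ))
  i11 : IntOn (Icc a b) (fun t => ((r t * t1 t * t1 t : ℝ) : ℂ))
  i22 : IntOn (Icc a b) (fun t => ((r t * t2 t * t2 t : ℝ) : ℂ))
  rpos : ∀ᵐ t, t ∈ Ioo a b → 0 < r t
  nd : ∀ e1 e2 : ℂ, (∀ᵐ t, t ∈ Ioo a b → e1 * t1 t + e2 * t2 t = 0) → e1 = 0 ∧ e2 = 0

/-- solutions of the canonical system -/
structure IsCan (I : Set ℝ) (r t1 t2 : ℝ → ℝ) (z : ℂ) (Y1 Y2 : ℝ → ℂ) : Prop where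
  fst : ACD I Y1 (fun t => z * (r t * t2 t * (t1 t * Y1 t + t2 t * Y2 t)))
  snd : ACD I Y2 (fun t => - z * (r t * t1 t * (t1 t * Y1 t + t2 t * Y2 t)))

lemma IsCan.det {I : Set ℝ} (hI : I.OrdConnected) {r t1 t2 : ℝ → ℝ} {z : ℂ} {Y1 Y2 Z1 Z2 : ℝ → ℂ}
    (hY : IsCan I r t1 t2 z Y1 Y2) (hZ : IsCan I r t1 t2 z Z1 Z2) :
    ∀ x ∈ I, ∀ y ∈ I, Y1 x * Z2 x - Y2 x * Z1 x = Y1 y * Z2 y - Y2 y * Z1 y := by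
  have h := (hY.fst.mul hI hZ.snd).sub (hY.snd.mul hI hZ.fst)
  apply h.const_of_zero hI
  intro x _
  beta_reduce
  ring

lemma IsCan.comb {I : Set ℝ} (hI : I.OrdConnected) {r t1 t2 : ℝ → ℝ} {z : ℂ} {Y1 Y2 Z1 Z2 : ℝ → ℂ}
    (hY : IsCan I r t1 t2 z Y1 Y2) (hZ : IsCan I r t1 t2 z Z1 Z2) (m : ℂ) :
    IsCan I r t1 t2 z (fun x => Z1 x - m * Y1 x) (fun x => Z2 x - m * Y2 x) := by
  refine ⟨(hZ.fst.sub (hY.fst.const_mul m)).congr hI (fun _ _ => rfl) ?_,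
    (hZ.snd.sub (hY.snd.const_mul m)).congr hI (fun _ _ => rfl) ?_⟩
  all_goals
    intro x _
    beta_reduce
    ring

/-- energy density -/
def enQ (r t1 t2 : ℝ → ℝ) (Y1 Y2 : ℝ → ℂ) (t : ℝ) : ℝ := r t * normSq (t1 t * Y1 t + t2 t * Y2 t)

lemma IsCan.lag {a b : ℝ} (hab : a ≤ b) {r t1 t2 : ℝ → ℝ} {z : ℂ} {Y1 Y2 : ℝ → ℂ}
    (hY : IsCan (Icc a b) r t1 t2 z Y1 Y2) :
    IntervalIntegrable (fun t => (z - conj z) * (enQ r t1 t2 Y1 Y2 t : ℂ)) volume a b ∧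
    (Y1 b * conj (Y2 b)).im - (Y1 a * conj (Y2 a)).im = z.im * ∫ t in a..b, enQ r t1 t2 Y1 Y2 t := by
  have hI : (Icc a b).OrdConnected := ordConnected_Icc
  have h := ((hY.fst.mul hI hY.snd.conj).sub (hY.snd.mul hI hY.fst.conj)).congr hI
    (f₁ := fun x => Y1 x * conj (Y2 x) - Y2 x * conj (Y1 x))
    (g₁ := fun t => (z - conj z) * (enQ r t1 t2 Y1 Y2 t : ℂ)) (fun _ _ => rfl) (by
      intro x _
      beta_reduce
      unfold enQ
      push_cast
      rw [← Complex.mul_conj]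
      simp only [map_mul, map_add, map_neg, Complex.conj_ofReal]
      ring)
  obtain ⟨h1, h2⟩ := h b (right_mem_Icc.2 hab) a (left_mem_Icc.2 hab)
  refine ⟨h1, ?_⟩
  rw [intervalIntegral.integral_const_mul, intervalIntegral.integral_ofReal] at h2
  have h3 := congrArg Complex.im h2
  simp at h3 ⊢
  linarith

lemma CanHyp.en_nonneg {a b : ℝ} {r t1 t2 : ℝ → ℝ} (H : CanHyp a b r t1 t2) (Y1 Y2 : ℝ → ℂ) :
    0 ≤ᵐ[volume.restrict (Ioc a b)] enQ r t1 t2 Y1 Y2 := by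
  rw [← restrict_Ioo_eq_restrict_Ioc]
  refine (ae_restrict_iff' measurableSet_Ioo).2 ?_
  filter_upwards [H.rpos] with t ht hti
  exact mul_nonneg (ht hti).le (normSq_nonneg _)

lemma CanHyp.en_int_nonneg {a b : ℝ} {r t1 t2 : ℝ → ℝ} (H : CanHyp a b r t1 t2) (Y1 Y2 : ℝ → ℂ) :
    0 ≤ ∫ t in a..b, enQ r t1 t2 Y1 Y2 t := by
  rw [intervalIntegral.integral_of_le H.lt.le]
  exact integral_nonneg_of_ae (H.en_nonneg Y1 Y2)

lemma IsCan.const_of_u {a b : ℝ} {r t1 t2 : ℝ → ℝ} (H : CanHyp a b r t1 t2) {z : ℂ} {Y1 Y2 : ℝ → ℂ}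
    (hY : IsCan (Icc a b) r t1 t2 z Y1 Y2) (h0 : ∀ᵐ t, t ∈ Ioo a b → t1 t * Y1 t + t2 t * Y2 t = 0) :
    ∀ x ∈ Icc a b, Y1 x = 0 ∧ Y2 x = 0 := by
  have hI : (Icc a b).OrdConnected := ordConnected_Icc
  have hne : ∀ c : ℝ, ∀ᵐ t : ℝ, t ≠ c := fun c => by simp [ae_iff, measure_singleton]
  have h0' : ∀ᵐ t, t ∈ Icc a b → t1 t * Y1 t + t2 t * Y2 t = 0 := by
    filter_upwards [h0, hne a, hne b] with t ht h1 h2 h3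
    exact ht ⟨lt_of_le_of_ne h3.1 h1.symm, lt_of_le_of_ne h3.2 h2⟩
  have k1 := (hY.fst.congr_ae hI (g₁ := fun _ => 0) (by
    filter_upwards [h0'] with t ht hti
    rw [ht hti]; simp)).const_of_zero hI (fun _ _ => rfl)
  have k2 := (hY.snd.congr_ae hI (g₁ := fun _ => 0) (by
    filter_upwards [h0'] with t ht hti
    rw [ht hti]; simp)).const_of_zero hI (fun _ _ => rfl)
  intro x hx
  apply H.nd
  filter_upwards [h0] with t ht hti
  rw [k1 x hx t (Ioo_subset_Icc_self hti), k2 x hx t (Ioo_subset_Icc_self hti), ← ht hti]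
  ring

lemma IsCan.zero_of_en {a b : ℝ} {r t1 t2 : ℝ → ℝ} (H : CanHyp a b r t1 t2) {z : ℂ} {Y1 Y2 : ℝ → ℂ}
    (hY : IsCan (Icc a b) r t1 t2 z Y1 Y2) (hz : z.im ≠ 0)
    (h0 : ∫ t in a..b, enQ r t1 t2 Y1 Y2 t = 0) : ∀ x ∈ Icc a b, Y1 x = 0 ∧ Y2 x = 0 := by
  have hint : IntervalIntegrable (enQ r t1 t2 Y1 Y2) volume a b := by
    have h1 := (hY.lag H.lt.le).1
    have hzz : z - conj z ≠ 0 := by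
      intro h
      have := congrArg Complex.im h
      simp at this
      exact hz (by linarith)
    have h2 := h1.const_mul ((z - conj z)⁻¹)
    have h3 : (fun x => (z - conj z)⁻¹ * ((z - conj z) * (enQ r t1 t2 Y1 Y2 x : ℂ))) =
      fun x => (enQ r t1 t2 Y1 Y2 x : ℂ) := by
      funext x
      rw [inv_mul_cancel_left₀ hzz]
    rw [h3] at h2
    exact ⟨h2.1.re, h2.2.re⟩
  apply hY.const_of_u H
  have h1 := (intervalIntegral.integral_eq_zero_iff_of_le_of_nonneg_ae H.lt.le (H.en_nonneg Y1 Y2) hint).1 h0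
  rw [← restrict_Ioo_eq_restrict_Ioc] at h1
  have h2 := (ae_restrict_iff' measurableSet_Ioo).1 h1
  filter_upwards [h2, H.rpos] with t ht hr hti
  have h3 := ht hti
  have h4 := hr hti
  simp only [enQ, Pi.zero_apply] at h3
  rcases mul_eq_zero.1 h3 with h5 | h5
  · exact absurd h5 h4.ne'
  · exact normSq_eq_zero.1 h5

/-- solution of the canonical system -/
def Cs1 (a : ℝ) (r t1 t2 : ℝ → ℝ) (y1 y2 z : ℂ) (x : ℝ) : ℂ :=
  sol1 (fun t => ((r t * t1 t * t2 t : ℝ) : ℂ)) (fun t => ((r t * t2 t * t2 t : ℝ) : ℂ))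
    (fun t => -((r t * t1 t * t1 t : ℝ) : ℂ)) (fun t => -((r t * t1 t * t2 t : ℝ) : ℂ)) a y1 y2 z x

/-- solution of the canonical system -/
def Cs2 (a : ℝ) (r t1 t2 : ℝ → ℝ) (y1 y2 z : ℂ) (x : ℝ) : ℂ :=
  sol2 (fun t => ((r t * t1 t * t2 t : ℝ) : ℂ)) (fun t => ((r t * t2 t * t2 t : ℝ) : ℂ))
    (fun t => -((r t * t1 t * t1 t : ℝ) : ℂ)) (fun t => -((r t * t1 t * t2 t : ℝ) : ℂ)) a y1 y2 z x

lemma IntOn.neg {I : Set ℝ} {k : ℝ → ℂ} (h : IntOn I k) : IntOn I (fun t => - k t) :=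
  fun x hx y hy => (h x hx y hy).neg

lemma Cs_can {a b : ℝ} {r t1 t2 : ℝ → ℝ} (H : CanHyp a b r t1 t2) (y1 y2 z : ℂ) :
    IsCan (Icc a b) r t1 t2 z (Cs1 a r t1 t2 y1 y2 z) (Cs2 a r t1 t2 y1 y2 z) := by
  have hI : (Icc a b).OrdConnected := ordConnected_Icc
  obtain ⟨h1, h2⟩ := sol_acd hI H.i12 H.i22 H.i11.neg H.i12.neg (left_mem_Icc.2 H.lt.le) y1 y2 z
  refine ⟨h1.congr hI (fun _ _ => rfl) ?_, h2.congr hI (fun _ _ => rfl) ?_⟩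
  all_goals
    intro t _
    simp only [Cs1, Cs2]
    push_cast
    ring

lemma Cs_init (a : ℝ) (r t1 t2 : ℝ → ℝ) (y1 y2 z : ℂ) :
    Cs1 a r t1 t2 y1 y2 z a = y1 ∧ Cs2 a r t1 t2 y1 y2 z a = y2 := sol_init _ _ _ _ _ _ _ _

lemma Cs_entire {a b : ℝ} {r t1 t2 : ℝ → ℝ} (H : CanHyp a b r t1 t2) (y1 y2 : ℂ) :
    ∃ M α : ℝ, (Differentiable ℂ (fun z => Cs1 a r t1 t2 y1 y2 z b) ∧
      ∀ z, ‖Cs1 a r t1 t2 y1 y2 z b‖ ≤ M * Real.exp (α * ‖z‖)) ∧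
    (Differentiable ℂ (fun z => Cs2 a r t1 t2 y1 y2 z b) ∧
      ∀ z, ‖Cs2 a r t1 t2 y1 y2 z b‖ ≤ M * Real.exp (α * ‖z‖)) :=
  sol_entire ordConnected_Icc H.i12 H.i22 H.i11.neg H.i12.neg (left_mem_Icc.2 H.lt.le) y1 y2
    (right_mem_Icc.2 H.lt.le)

lemma exists_compl {e1 e2 : ℝ} (he : e1 ≠ 0 ∨ e2 ≠ 0) : ∃ f1 f2 : ℝ, e1 * f2 - e2 * f1 = 1 := by
  have hN : 0 < e1 ^ 2 + e2 ^ 2 := by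
    rcases he with h | h
    · have := sq_pos_of_ne_zero h; nlinarith [sq_nonneg e2]
    · have := sq_pos_of_ne_zero h; nlinarith [sq_nonneg e1]
  refine ⟨-e2 / (e1 ^ 2 + e2 ^ 2), e1 / (e1 ^ 2 + e2 ^ 2), ?_⟩
  field_simp
  ring

/-- characteristic function -/
def Gf (a b : ℝ) (r t1 t2 : ℝ → ℝ) (e1 e2 k1 k2 : ℝ) (z : ℂ) : ℂ :=
  Cs1 a r t1 t2 e1 e2 z b * k2 - Cs2 a r t1 t2 e1 e2 z b * k1

lemma Gf_real {a b : ℝ} {r t1 t2 : ℝ → ℝ} (H : CanHyp a b r t1 t2) {e1 e2 k1 k2 : ℝ}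
    (he : e1 ≠ 0 ∨ e2 ≠ 0) (hk : k1 ≠ 0 ∨ k2 ≠ 0) {z : ℂ} (hz : Gf a b r t1 t2 e1 e2 k1 k2 z = 0) :
    z.im = 0 := by
  by_contra hne
  have hY := Cs_can H e1 e2 z
  obtain ⟨i1, i2⟩ := Cs_init a r t1 t2 e1 e2 z
  have hl := (hY.lag H.lt.le).2
  unfold Gf at hz
  set A := Cs1 a r t1 t2 e1 e2 z b
  set B := Cs2 a r t1 t2 e1 e2 z b
  have h1 : (A * conj B).im = 0 := by
    have hre := congrArg Complex.re hz
    have him := congrArg Complex.im hz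
    simp at hre him ⊢
    rcases hk with h | h
    · apply mul_left_cancel₀ h
      linear_combination (-A.im) * hre + A.re * him
    · apply mul_left_cancel₀ h
      linear_combination (-B.im) * hre + B.re * him
  have h2 : (Cs1 a r t1 t2 e1 e2 z a * conj (Cs2 a r t1 t2 e1 e2 z a)).im = 0 := by
    rw [i1, i2]; simp
  rw [h1, h2, sub_zero, eq_comm] at hl
  have h3 := hY.zero_of_en H hne ((mul_eq_zero.1 hl).resolve_left hne) a (left_mem_Icc.2 H.lt.le)
  rw [i1, i2] at h3
  rcases he with h | h
  · exact h (by exact_mod_cast h3.1)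
  · exact h (by exact_mod_cast h3.2)

lemma Gf_cartwright {a b : ℝ} {r t1 t2 : ℝ → ℝ} (H : CanHyp a b r t1 t2) {e1 e2 : ℝ} (k1 k2 : ℝ)
    (he : e1 ≠ 0 ∨ e2 ≠ 0) : CartwrightClass (Gf a b r t1 t2 e1 e2 k1 k2) := by
  obtain ⟨f1, f2, hf⟩ := exists_compl he
  obtain ⟨M, α, ⟨dA, bA⟩, ⟨dB, bB⟩⟩ := Cs_entire H (e1:ℂ) (e2:ℂ)
  obtain ⟨M', α', ⟨dC, -⟩, ⟨dD, -⟩⟩ := Cs_entire H (f1:ℂ) (f2:ℂ)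
  have hfc : (e1:ℂ) * f2 - e2 * f1 = 1 := by exact_mod_cast hf
  have hd : Differentiable ℂ (Gf a b r t1 t2 e1 e2 k1 k2) := (dA.mul_const _).sub (dB.mul_const _)
  refine ⟨hd, ⟨M * (|k2| + |k1|), α, ?_⟩, ?_⟩
  · intro z
    unfold Gf
    refine (norm_sub_le _ _).trans ?_
    rw [norm_mul, norm_mul, Complex.norm_real, Complex.norm_real, Real.norm_eq_abs, Real.norm_eq_abs]
    have h1 := mul_le_mul_of_nonneg_right (bA z) (abs_nonneg k2)
    have h2 := mul_le_mul_of_nonneg_right (bB z) (abs_nonneg k1)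
    nlinarith
  · have hab := H.lt.le
    have key : ∀ z : ℂ, 0 ≤ z.im →
        ‖Cs1 a r t1 t2 e1 e2 z b‖ ^ 2 + ‖Cs2 a r t1 t2 e1 e2 z b‖ ^ 2 ≤
          ‖Cs1 a r t1 t2 e1 e2 z b + I * Cs2 a r t1 t2 e1 e2 z b‖ ^ 2 := by
      intro z hz
      have hl := ((Cs_can H e1 e2 z).lag hab).2
      obtain ⟨i1, i2⟩ := Cs_init a r t1 t2 e1 e2 z
      have h2 : (Cs1 a r t1 t2 e1 e2 z a * conj (Cs2 a r t1 t2 e1 e2 z a)).im = 0 := by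
        rw [i1, i2]; simp
      have h3 := mul_nonneg hz (H.en_int_nonneg (Cs1 a r t1 t2 e1 e2 z) (Cs2 a r t1 t2 e1 e2 z))
      rw [← hl, h2, sub_zero] at h3
      rw [← Complex.normSq_eq_norm_sq, ← Complex.normSq_eq_norm_sq, ← Complex.normSq_eq_norm_sq]
      simp [Complex.normSq_apply] at h3 ⊢
      nlinarith
    have hdet : ∀ z : ℂ, Cs1 a r t1 t2 e1 e2 z b * Cs2 a r t1 t2 f1 f2 z b
        - Cs2 a r t1 t2 e1 e2 z b * Cs1 a r t1 t2 f1 f2 z b = 1 := by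
      intro z
      rw [(Cs_can H e1 e2 z).det ordConnected_Icc (Cs_can H f1 f2 z) b (right_mem_Icc.2 hab) a (left_mem_Icc.2 hab),
        (Cs_init a r t1 t2 e1 e2 z).1, (Cs_init a r t1 t2 e1 e2 z).2,
        (Cs_init a r t1 t2 f1 f2 z).1, (Cs_init a r t1 t2 f1 f2 z).2]
      exact hfc
    have hE0 : ∀ z : ℂ, 0 ≤ z.im → Cs1 a r t1 t2 e1 e2 z b + I * Cs2 a r t1 t2 e1 e2 z b ≠ 0 := by
      intro z hz h0
      have h1 := key z hz
      rw [h0] at h1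
      simp at h1
      have hA : Cs1 a r t1 t2 e1 e2 z b = 0 := by
        rw [← norm_eq_zero, ← sq_eq_zero_iff]
        nlinarith [sq_nonneg ‖Cs1 a r t1 t2 e1 e2 z b‖, sq_nonneg ‖Cs2 a r t1 t2 e1 e2 z b‖]
      have hB : Cs2 a r t1 t2 e1 e2 z b = 0 := by
        rw [← norm_eq_zero, ← sq_eq_zero_iff]
        nlinarith [sq_nonneg ‖Cs1 a r t1 t2 e1 e2 z b‖, sq_nonneg ‖Cs2 a r t1 t2 e1 e2 z b‖]
      have := hdet z
      rw [hA, hB] at this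
      simp at this
    apply log_int (E := fun z => Cs1 a r t1 t2 e1 e2 z b + I * Cs2 a r t1 t2 e1 e2 z b)
      (F := fun z => Cs1 a r t1 t2 f1 f2 z b + I * Cs2 a r t1 t2 f1 f2 z b) (k := |k2| + |k1|)
      (dA.add (dB.const_mul I)) (dC.add (dD.const_mul I)) hd hE0
    · intro z hz
      have hE := hE0 z hz
      have hdz := hdet z
      set m := (Cs1 a r t1 t2 f1 f2 z b + I * Cs2 a r t1 t2 f1 f2 z b) /
        (Cs1 a r t1 t2 e1 e2 z b + I * Cs2 a r t1 t2 e1 e2 z b) with hm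
      have hZ := (Cs_can H e1 e2 z).comb ordConnected_Icc (Cs_can H f1 f2 z) m
      have hl := (hZ.lag hab).2
      have h3 := mul_nonneg hz (H.en_int_nonneg (fun x => Cs1 a r t1 t2 f1 f2 z x - m * Cs1 a r t1 t2 e1 e2 z x)
         (fun x => Cs2 a r t1 t2 f1 f2 z x - m * Cs2 a r t1 t2 e1 e2 z x))
      rw [← hl] at h3

      rw [(Cs_init a r t1 t2 e1 e2 z).1, (Cs_init a r t1 t2 e1 e2 z).2,
        (Cs_init a r t1 t2 f1 f2 z).1, (Cs_init a r t1 t2 f1 f2 z).2] at h3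
      have ha : (((f1:ℂ) - m * e1) * conj ((f2:ℂ) - m * e2)).im = - m.im := by
        simp
        linear_combination (-m.im) * hf
      rw [ha] at h3
      set A := Cs1 a r t1 t2 e1 e2 z b
      set B := Cs2 a r t1 t2 e1 e2 z b
      set C := Cs1 a r t1 t2 f1 f2 z b
      set D := Cs2 a r t1 t2 f1 f2 z b
      have hI : (I:ℂ) ^ 2 = -1 := Complex.I_sq
      have z2 : D - m * B = 1 / (A + I * B) := by
        rw [hm]
        field_simp
        linear_combination hdz
      have z1 : C - m * A = - I * (1 / (A + I * B)) := by
        rw [hm]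
        field_simp
        linear_combination (-I) * hdz
      rw [z1, z2] at h3
      have hn : (-I * (1 / (A + I * B)) * conj (1 / (A + I * B))).im = - (1 / ‖A + I * B‖ ^ 2) := by
        rw [mul_assoc, Complex.mul_conj, map_div₀, map_one, Complex.normSq_eq_norm_sq]
        simp
        rw [← Complex.ofReal_pow, Complex.ofReal_re]
        have := norm_pos_iff.2 hE
        field_simp
      rw [hn] at h3
      linarith
    · intro t
      have h1 := key t (by simp)
      unfold Gf
      refine (norm_sub_le _ _).trans ?_
      rw [norm_mul, norm_mul, Complex.norm_real, Complex.norm_real, Real.norm_eq_abs, Real.norm_eq_abs]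
      set A := Cs1 a r t1 t2 e1 e2 t b
      set B := Cs2 a r t1 t2 e1 e2 t b
      have hA : ‖A‖ ≤ ‖A + I * B‖ := abs_le_of_sq_le_sq' (by nlinarith [sq_nonneg ‖B‖]) (norm_nonneg _) |>.2
      have hB : ‖B‖ ≤ ‖A + I * B‖ := abs_le_of_sq_le_sq' (by nlinarith [sq_nonneg ‖A‖]) (norm_nonneg _) |>.2
      nlinarith [abs_nonneg k1, abs_nonneg k2]

lemma IntOn.ofReal {I : Set ℝ} {k : ℝ → ℝ} (h : ∀ x ∈ I, ∀ y ∈ I, IntervalIntegrable k volume y x) :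
    IntOn I (fun t => (k t : ℂ)) := fun x hx y hy =>
    ⟨(h x hx y hy).1.ofReal, (h x hx y hy).2.ofReal⟩

/-- real fundamental system at spectral parameter 0 -/
structure FS (a b : ℝ) (p q r s : ℝ → ℝ) (θ θq φ φq : ℝ → ℝ) : Prop where
  th : SLSys a b p q r s (fun x => (θ x : ℂ)) (fun x => (θq x : ℂ)) (fun x => 0 * (θ x : ℂ))
  ph : SLSys a b p q r s (fun x => (φ x : ℂ)) (fun x => (φq x : ℂ)) (fun x => 0 * (φ x : ℂ))
  w : ∀ x ∈ Ioo a b, θ x * φq x - θq x * φ x = 1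

lemma exists_real_sol {a b : ℝ} {p q r s : ℝ → ℝ} (hyp : SLHyp a b p q r s) {c : ℝ}
    (hc : c ∈ Ioo a b) (y1 y2 : ℝ) : ∃ f fq : ℝ → ℝ,
    SLSys a b p q r s (fun x => (f x : ℂ)) (fun x => (fq x : ℂ)) (fun x => 0 * (f x : ℂ)) ∧
    f c = y1 ∧ fq c = y2 := by
  have h11 : IntOn (Ioo a b) (fun t => -(s t : ℂ)) := fun x hx y hy => (IntOn.ofReal hyp.is' x hx y hy).neg
  have h12 := IntOn.ofReal hyp.ip
  have h21 := IntOn.ofReal hyp.iq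
  have h22 := IntOn.ofReal hyp.is'
  have H := sol_acd ordConnected_Ioo h11 h12 h21 h22 hc y1 y2 1
  have hi := sol_init (fun t => -(s t : ℂ)) (fun t => (((p t)⁻¹ : ℝ) : ℂ)) (fun t => (q t : ℂ))
    (fun t => (s t : ℂ)) c y1 y2 1
  set f := sol1 (fun t => -(s t : ℂ)) (fun t => (((p t)⁻¹ : ℝ) : ℂ)) (fun t => (q t : ℂ))
    (fun t => (s t : ℂ)) c y1 y2 1
  set g := sol2 (fun t => -(s t : ℂ)) (fun t => (((p t)⁻¹ : ℝ) : ℂ)) (fun t => (q t : ℂ))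
    (fun t => (s t : ℂ)) c y1 y2 1
  refine ⟨fun x => (f x).re, fun x => (g x).re, ⟨?_, ?_⟩, by simp [hi.1], by simp [hi.2]⟩
  · refine H.1.re.congr ordConnected_Ioo (fun _ _ => rfl) (fun t _ => ?_)
    apply Complex.ext <;> simp [Complex.div_re, Complex.div_im, Complex.normSq]
    by_cases hp : p t = 0
    · simp [hp]
    · field_simp; ring
  · refine H.2.re.congr ordConnected_Ioo (fun _ _ => rfl) (fun t _ => ?_)
    apply Complex.ext <;> simp
    ring

lemma FS_exists {a b : ℝ} {p q r s : ℝ → ℝ} (hyp : SLHyp a b p q r s) :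
    ∃ θ θq φ φq : ℝ → ℝ, FS a b p q r s θ θq φ φq := by
  have hab := hyp.lt
  have hc : (a + b) / 2 ∈ Ioo a b := ⟨by linarith, by linarith⟩
  obtain ⟨θ, θq, h1, h2, h3⟩ := exists_real_sol hyp hc 1 0
  obtain ⟨φ, φq, g1, g2, g3⟩ := exists_real_sol hyp hc 0 1
  refine ⟨θ, θq, φ, φq, h1, g1, ?_⟩
  have hw := (ACD.mul ordConnected_Ioo h1.fst g1.snd).sub (ACD.mul ordConnected_Ioo h1.snd g1.fst)
  intro x hx
  have := hw.const_of_zero ordConnected_Ioo (fun t _ => by ring) x hx _ hc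
  beta_reduce at this
  rw [h2, h3, g2, g3] at this
  have h4 : ((θ x * φq x - θq x * φ x : ℝ) : ℂ) = ((1:ℝ):ℂ) := by
    push_cast
    rw [this]; simp
  exact_mod_cast h4

lemma integrableOn_split {a b c : ℝ} (hc : c ∈ Ioo a b) {f : ℝ → ℝ} (h1 : IntegrableOn f (Ioo a c))
    (h2 : IntegrableOn f (Ioo c b)) : IntegrableOn f (Ioo a b) := by
  have h3 : IntegrableOn f (Ioc a c) := (integrableOn_Ioc_iff_integrableOn_Ioo (by simp)).2 h1
  have := h3.union h2
  rwa [Ioc_union_Ioo_eq_Ioo hc.1.le hc.2] at this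

lemma IntOn.of_Ioo {a b : ℝ} {k : ℝ → ℂ} (h : IntegrableOn k (Ioo a b)) :
    IntOn (Icc a b) k := by
  intro x hx y hy
  have h2 : IntegrableOn k (Icc a b) := (integrableOn_Icc_iff_integrableOn_Ioo (by simp) (by simp)).2 h
  exact (h2.mono_set (ordConnected_Icc.uIcc_subset hy hx)).intervalIntegrable

lemma IntOn.aesm {a b : ℝ} {k : ℝ → ℂ} (h : IntOn (Ioo a b) k) :
    AEStronglyMeasurable k (volume.restrict (Ioo a b)) := by
  have : LocallyIntegrableOn k (Ioo a b) := by
    rw [locallyIntegrableOn_iff isOpen_Ioo.isLocallyClosed]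
    intro K hK hKc
    rcases K.eq_empty_or_nonempty with rfl | hne
    · simp
    · have h1 := hK (hKc.sInf_mem hne)
      have h2 := hK (hKc.sSup_mem hne)
      have h3 := ((intervalIntegrable_iff' (by simp)).1 (h _ h2 _ h1))
      refine h3.mono_set (fun x hx => ?_)
      rw [uIcc_of_le (csInf_le_csSup hne hKc.bddBelow hKc.bddAbove)]
      exact ⟨csInf_le hKc.bddBelow hx, le_csSup hKc.bddAbove hx⟩
  exact this.aestronglyMeasurable

lemma ACD.cont {a b : ℝ} {f g : ℝ → ℂ} (h : ACD (Ioo a b) f g) : ContinuousOn f (Ioo a b) :=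
  h.continuousOn ordConnected_Ioo (Or.inr rfl)

lemma ACD.contI {a b : ℝ} {f g : ℝ → ℂ} (h : ACD (Icc a b) f g) : ContinuousOn f (Icc a b) :=
  h.continuousOn ordConnected_Icc (Or.inl rfl)

lemma real_aesm {a b : ℝ} {f : ℝ → ℝ} {g : ℝ → ℂ} (h : ACD (Ioo a b) (fun x => (f x : ℂ)) g) :
    AEStronglyMeasurable f (volume.restrict (Ioo a b)) := by
  have h1 : ContinuousOn f (Ioo a b) := by
    have := Complex.continuous_re.comp_continuousOn h.cont
    exact this.congr (fun x _ => by simp)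
  exact h1.aestronglyMeasurable measurableSet_Ioo

lemma eqOn_zero_of_ae {a b : ℝ} {f : ℝ → ℂ} (hf : ContinuousOn f (Ioo a b))
    (h : ∀ᵐ t, t ∈ Ioo a b → f t = 0) : ∀ t ∈ Ioo a b, f t = 0 := by
  have := Measure.eqOn_open_of_ae_eq (μ := volume) (f := f) (g := fun _ => 0) (U := Ioo a b)
    ((ae_restrict_iff' measurableSet_Ioo).2 h) isOpen_Ioo hf continuousOn_const
  exact this

lemma ACD.ae_deriv_Ioo {a b : ℝ} {f g : ℝ → ℂ} (h : ACD (Ioo a b) f g)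
    (hf : ∀ t ∈ Ioo a b, f t = 0) : ∀ᵐ t, t ∈ Ioo a b → g t = 0 := by
  have key : ∀ n : ℕ, ∀ᵐ t, t ∈ Icc (a + 1 / (n+1:ℝ)) (b - 1 / (n+1:ℝ)) → g t = 0 := by
    intro n
    have hn : (0:ℝ) < 1 / (n+1:ℝ) := by positivity
    rcases lt_or_ge (b - 1 / (n+1:ℝ)) (a + 1 / (n+1:ℝ)) with hlt | hle
    · rw [Icc_eq_empty (not_le.2 hlt)]; simp
    · have h1 : a + 1 / (n+1:ℝ) ∈ Ioo a b := ⟨by linarith, by linarith⟩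
      have h2 : b - 1 / (n+1:ℝ) ∈ Ioo a b := ⟨by linarith, by linarith⟩
      filter_upwards [h.ae_deriv ordConnected_Ioo h1 h2] with t ht htI
      rw [uIcc_of_le hle] at ht
      have h3 := ht htI
      have h4 : HasDerivAt f 0 t := by
        refine (hasDerivAt_const t (0:ℂ)).congr_of_eventuallyEq ?_
        filter_upwards [isOpen_Ioo.mem_nhds (show t ∈ Ioo a b from ⟨by linarith [htI.1], by linarith [htI.2]⟩)] with y hy
        exact hf y hy
      exact h3.unique h4
  filter_upwards [ae_all_iff.2 key] with t ht htI
  obtain ⟨n, hn⟩ := exists_nat_one_div_lt (show 0 < min (t - a) (b - t) from lt_min (by linarith [htI.1]) (by linarith [htI.2]))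
  have := lt_min_iff.1 hn
  exact ht n ⟨by linarith [this.1], by linarith [this.2]⟩

lemma FS.can {a b : ℝ} {p q r s : ℝ → ℝ} (hyp : SLHyp a b p q r s)
    (hlca : ∀ z : ℂ, ∀ u uq : ℝ → ℂ, SLSys a b p q r s u uq (fun x => z * u x) →
      ∀ c ∈ Set.Ioo a b, IntegrableOn (fun x => ‖u x‖ ^ 2 * r x) (Set.Ioo a c))
    (hlcb : ∀ z : ℂ, ∀ u uq : ℝ → ℂ, SLSys a b p q r s u uq (fun x => z * u x) →
      ∀ c ∈ Set.Ioo a b, IntegrableOn (fun x => ‖u x‖ ^ 2 * r x) (Set.Ioo c b))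
    {θ θq φ φq : ℝ → ℝ} (F : FS a b p q r s θ θq φ φq) :
    CanHyp a b r θ φ ∧ IntegrableOn (fun t => r t * θ t ^ 2) (Ioo a b) ∧
      IntegrableOn (fun t => r t * φ t ^ 2) (Ioo a b) := by
  have hab := hyp.lt
  have hc : (a + b) / 2 ∈ Ioo a b := ⟨by linarith, by linarith⟩
  have e1 : IntegrableOn (fun t => r t * θ t ^ 2) (Ioo a b) := by
    refine (integrableOn_split hc (hlca 0 _ _ F.th _ hc) (hlcb 0 _ _ F.th _ hc)).congr_fun
      (fun x _ => ?_) measurableSet_Ioo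
    simp; ring
  have e2 : IntegrableOn (fun t => r t * φ t ^ 2) (Ioo a b) := by
    refine (integrableOn_split hc (hlca 0 _ _ F.ph _ hc) (hlcb 0 _ _ F.ph _ hc)).congr_fun
      (fun x _ => ?_) measurableSet_Ioo
    simp; ring
  have e3 : IntegrableOn (fun t => r t * θ t * φ t) (Ioo a b) := by
    refine (e1.add e2).mono' ((hyp.mr.aestronglyMeasurable.mul (real_aesm F.th.fst)).mul (real_aesm F.ph.fst)) ?_
    filter_upwards [hyp.rpos] with t ht
    rw [Real.norm_eq_abs, mul_assoc, abs_mul, abs_of_pos ht]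
    have h5 : |θ t * φ t| ≤ θ t ^ 2 + φ t ^ 2 :=
      abs_le.2 ⟨by nlinarith [sq_nonneg (θ t + φ t), sq_nonneg (θ t), sq_nonneg (φ t)],
        by nlinarith [sq_nonneg (θ t - φ t), sq_nonneg (θ t), sq_nonneg (φ t)]⟩
    have := mul_le_mul_of_nonneg_left h5 ht.le
    simp only [Pi.add_apply]
    linarith
  have hr : ∀ᵐ t, t ∈ Ioo a b → 0 < r t := (ae_restrict_iff' measurableSet_Ioo).1 hyp.rpos
  have hp : ∀ᵐ t, t ∈ Ioo a b → p t ≠ 0 := (ae_restrict_iff' measurableSet_Ioo).1 hyp.pne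
  refine ⟨⟨hab, IntOn.of_Ioo e3.ofReal, IntOn.of_Ioo ?_, IntOn.of_Ioo ?_, hr, ?_⟩, e1, e2⟩
  · refine IntegrableOn.congr_fun (Integrable.ofReal e1) (fun x _ => ?_) measurableSet_Ioo
    simp; ring
  · refine IntegrableOn.congr_fun (Integrable.ofReal e2) (fun x _ => ?_) measurableSet_Ioo
    simp; ring
  · intro c1 c2 hz
    have A1 := (ACD.const_mul c1 F.th.fst).add (ACD.const_mul c2 F.ph.fst)
    have A2 := (ACD.const_mul c1 F.th.snd).add (ACD.const_mul c2 F.ph.snd)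
    have hz1 := eqOn_zero_of_ae A1.cont hz
    have hd := ACD.ae_deriv_Ioo A1 hz1
    have hz2 := eqOn_zero_of_ae A2.cont (by
      filter_upwards [hd, hp] with t h1 h2 htI
      have h3 := h1 htI
      have h4 := hz1 t htI
      have h5 : (p t : ℂ) ≠ 0 := by exact_mod_cast h2 htI
      field_simp at h3
      linear_combination h3 + (p t : ℂ) * s t * h4)
    have q1 := hz1 _ hc
    have q2 := hz2 _ hc
    have q3 : ((θ ((a+b)/2) * φq ((a+b)/2) - θq ((a+b)/2) * φ ((a+b)/2) : ℝ) : ℂ) = ((1:ℝ):ℂ) := by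
      rw [F.w _ hc]
    push_cast at q3
    beta_reduce at q1 q2
    constructor
    · linear_combination (φq ((a+b)/2) : ℂ) * q1 - (φ ((a+b)/2) : ℂ) * q2 - c1 * q3
    · linear_combination (θ ((a+b)/2) : ℂ) * q2 - (θq ((a+b)/2) : ℂ) * q1 - c2 * q3

/-- coordinates of a function in the domain with respect to the fundamental system -/
structure SLExt (a b : ℝ) (r θ θq φ φq : ℝ → ℝ) (f fq w Y1 Y2 : ℝ → ℂ) : Prop where
  A1 : ACD (Icc a b) Y1 (fun t => (r t : ℂ) * w t * φ t)
  A2 : ACD (Icc a b) Y2 (fun t => -((r t : ℂ) * w t * θ t))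
  e1 : ∀ x ∈ Ioo a b, f x = Y1 x * θ x + Y2 x * φ x
  e2 : ∀ x ∈ Ioo a b, fq x = Y1 x * θq x + Y2 x * φq x

lemma ACD.extend {a b : ℝ} (hab : a < b) {Y k : ℝ → ℂ} (h : ACD (Ioo a b) Y k)
    (hk : IntegrableOn k (Ioo a b)) : ∃ Z, ACD (Icc a b) Z k ∧ ∀ x ∈ Ioo a b, Z x = Y x := by
  have hc : (a + b) / 2 ∈ Ioo a b := ⟨by linarith, by linarith⟩
  have h1 := (IntOn.of_Ioo hk).acd (Ioo_subset_Icc_self hc)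
  refine ⟨fun x => Y ((a+b)/2) + ∫ t in ((a+b)/2)..x, k t, ?_, ?_⟩
  · intro x hx y hy
    refine ⟨(h1 x hx y hy).1, ?_⟩
    have := (h1 x hx y hy).2
    beta_reduce at this ⊢
    rw [this]; ring
  · intro x hx
    exact ((h x hx _ hc).2).symm

lemma FS.wC {a b : ℝ} {p q r s : ℝ → ℝ} {θ θq φ φq : ℝ → ℝ} (F : FS a b p q r s θ θq φ φq)
    {x : ℝ} (hx : x ∈ Ioo a b) : (θ x : ℂ) * φq x - θq x * φ x = 1 := by
  have h4 : ((θ x * φq x - θq x * φ x : ℝ) : ℂ) = ((1:ℝ):ℂ) := by rw [F.w x hx]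
  push_cast at h4
  exact h4

lemma rwf_int {a b : ℝ} {r f : ℝ → ℝ} {w : ℝ → ℂ}
    (hr : ∀ᵐ t ∂(volume.restrict (Set.Ioo a b)), 0 < r t)
    (hf : IntegrableOn (fun t => r t * f t ^ 2) (Ioo a b))
    (hw : IntegrableOn (fun x => ‖w x‖ ^ 2 * r x) (Ioo a b))
    (hm : AEStronglyMeasurable (fun t => (r t : ℂ) * w t * f t) (volume.restrict (Ioo a b))) :
    IntegrableOn (fun t => (r t : ℂ) * w t * f t) (Ioo a b) := by
  refine (hf.add hw).mono' hm ?_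
  filter_upwards [hr] with t ht
  rw [norm_mul, norm_mul, Complex.norm_real, Complex.norm_real, Real.norm_eq_abs, Real.norm_eq_abs,
    abs_of_pos ht, mul_assoc]
  have h5 : ‖w t‖ * |f t| ≤ f t ^ 2 + ‖w t‖ ^ 2 := by
    nlinarith [sq_nonneg (‖w t‖ - |f t|), sq_abs (f t), sq_nonneg (f t), sq_nonneg ‖w t‖]
  have := mul_le_mul_of_nonneg_left h5 ht.le
  simp only [Pi.add_apply]
  linarith

lemma SLExt_exists {a b : ℝ} {p q r s : ℝ → ℝ} (hyp : SLHyp a b p q r s)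
    {θ θq φ φq : ℝ → ℝ} (F : FS a b p q r s θ θq φ φq)
    (i1 : IntegrableOn (fun t => r t * θ t ^ 2) (Ioo a b))
    (i2 : IntegrableOn (fun t => r t * φ t ^ 2) (Ioo a b))
    {f fq w : ℝ → ℂ} (hs : SLSys a b p q r s f fq w)
    (hw : IntegrableOn (fun x => ‖w x‖ ^ 2 * r x) (Ioo a b)) :
    ∃ Y1 Y2, SLExt a b r θ θq φ φq f fq w Y1 Y2 := by
  have hY1 := (ACD.mul ordConnected_Ioo hs.fst F.ph.snd).sub (ACD.mul ordConnected_Ioo hs.snd F.ph.fst)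
  have hY2 := (ACD.mul ordConnected_Ioo F.th.fst hs.snd).sub (ACD.mul ordConnected_Ioo F.th.snd hs.fst)
  have B1 : ACD (Ioo a b) (fun x => f x * φq x - fq x * φ x) (fun t => (r t : ℂ) * w t * φ t) :=
    hY1.congr ordConnected_Ioo (fun _ _ => rfl) (fun t _ => by ring)
  have B2 : ACD (Ioo a b) (fun x => θ x * fq x - θq x * f x) (fun t => (r t : ℂ) * (-w t) * θ t) :=
    hY2.congr ordConnected_Ioo (fun _ _ => rfl) (fun t _ => by ring)
  have m1 := IntOn.aesm (fun x hx y hy => (B1 x hx y hy).1)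
  have m2 := IntOn.aesm (fun x hx y hy => (B2 x hx y hy).1)
  obtain ⟨Y1, hA1, hE1⟩ := B1.extend hyp.lt (rwf_int hyp.rpos i2 hw m1)
  obtain ⟨Y2, hA2, hE2⟩ := B2.extend hyp.lt
    (rwf_int (w := fun t => - w t) hyp.rpos i1 (by simpa using hw) m2)
  refine ⟨Y1, Y2, hA1, hA2.congr ordConnected_Icc (fun _ _ => rfl) (fun t _ => by ring), ?_, ?_⟩
  · intro x hx
    rw [hE1 x hx, hE2 x hx]
    linear_combination (-f x) * F.wC hx
  · intro x hx
    rw [hE1 x hx, hE2 x hx]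
    linear_combination (-fq x) * F.wC hx

/-- endpoint data -/
structure EP (a b x0 : ℝ) (l : Filter ℝ) : Prop where
  le : l ≤ 𝓝[Icc a b] x0
  mem : Ioo a b ∈ l
  ne : l.NeBot
  x0 : x0 ∈ Icc a b

lemma EP_left {a b : ℝ} (hab : a < b) : EP a b a (𝓝[>] a) :=
  ⟨by rw [← nhdsWithin_Ioo_eq_nhdsGT hab]; exact nhdsWithin_mono _ Ioo_subset_Icc_self,
   Ioo_mem_nhdsGT hab, inferInstance, left_mem_Icc.2 hab.le⟩

lemma EP_right {a b : ℝ} (hab : a < b) : EP a b b (𝓝[<] b) :=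
  ⟨by rw [← nhdsWithin_Ioo_eq_nhdsLT hab]; exact nhdsWithin_mono _ Ioo_subset_Icc_self,
   Ioo_mem_nhdsLT hab, inferInstance, right_mem_Icc.2 hab.le⟩

lemma EP.wr {a b x0 : ℝ} {l : Filter ℝ} (E : EP a b x0 l) {p q r s : ℝ → ℝ} 
    {θ θq φ φq : ℝ → ℝ} (F : FS a b p q r s θ θq φ φq)
    {f fq w Y1 Y2 g gq gw V1 V2 : ℝ → ℂ} (hf : SLExt a b r θ θq φ φq f fq w Y1 Y2)
    (hg : SLExt a b r θ θq φ φq g gq gw V1 V2) :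
    Tendsto (Wr f fq (fun x => conj (g x)) (fun x => conj (gq x))) l
      (𝓝 (Y1 x0 * conj (V2 x0) - Y2 x0 * conj (V1 x0))) := by
  have c1 := (hf.A1.contI x0 E.x0).mono_left E.le
  have c2 := (hf.A2.contI x0 E.x0).mono_left E.le
  have c3 := (Complex.continuous_conj.tendsto _).comp ((hg.A1.contI x0 E.x0).mono_left E.le)
  have c4 := (Complex.continuous_conj.tendsto _).comp ((hg.A2.contI x0 E.x0).mono_left E.le)
  refine ((c1.mul c4).sub (c2.mul c3)).congr' ?_
  filter_upwards [E.mem] with x hx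
  simp only [Wr, Function.comp]
  rw [hf.e1 x hx, hf.e2 x hx, hg.e1 x hx, hg.e2 x hx]
  simp only [map_add, map_mul, Complex.conj_ofReal]
  linear_combination (-(Y1 x * conj (V2 x) - Y2 x * conj (V1 x))) * F.wC hx

lemma exists_real_dir {V1 V2 : ℂ} (h : V1 * conj V2 - V2 * conj V1 = 0) (hne : V1 ≠ 0 ∨ V2 ≠ 0) :
    ∃ e1 e2 : ℝ, (e1 ≠ 0 ∨ e2 ≠ 0) ∧ ∃ κ : ℂ, κ ≠ 0 ∧ V1 = κ * e1 ∧ V2 = κ * e2 := by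
  by_cases h1 : V1 = 0
  · subst h1
    exact ⟨0, 1, Or.inr one_ne_zero, V2, by simpa using hne, by simp, by simp⟩
  · have h1c : conj V1 ≠ 0 := by simpa using h1
    have : conj (V2 / V1) = V2 / V1 := by
      rw [map_div₀]
      field_simp
      linear_combination h
    obtain ⟨ρ, hρ⟩ := Complex.conj_eq_iff_real.1 this
    refine ⟨1, ρ, Or.inl one_ne_zero, V1, h1, by simp, ?_⟩
    rw [← hρ]; field_simp

lemma EP.bc {a b x0 : ℝ} {l : Filter ℝ} (E : EP a b x0 l) {p q r s : ℝ → ℝ}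
    (hyp : SLHyp a b p q r s)
    {θ θq φ φq : ℝ → ℝ} (F : FS a b p q r s θ θq φ φq)
    (i1 : IntegrableOn (fun t => r t * θ t ^ 2) (Ioo a b))
    (i2 : IntegrableOn (fun t => r t * φ t ^ 2) (Ioo a b))
    {v vq vw : ℝ → ℂ} (hv : MaxDom a b p q r s v vq vw)
    (hva : Tendsto (Wr v vq (fun x => conj (v x)) (fun x => conj (vq x))) l (𝓝 0))
    (hvnd : ∃ h hq hw : ℝ → ℂ, MaxDom a b p q r s h hq hw ∧ ∃ L : ℂ, L ≠ 0 ∧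
      Tendsto (Wr h hq (fun x => conj (v x)) (fun x => conj (vq x))) l (𝓝 L)) :
    ∃ e1 e2 : ℝ, (e1 ≠ 0 ∨ e2 ≠ 0) ∧ ∀ f fq w Y1 Y2, SLExt a b r θ θq φ φq f fq w Y1 Y2 →
      (Tendsto (Wr f fq (fun x => conj (v x)) (fun x => conj (vq x))) l (𝓝 0) ↔
        Y1 x0 * e2 - Y2 x0 * e1 = 0) := by
  have := E.ne
  obtain ⟨V1, V2, hV⟩ := SLExt_exists hyp F i1 i2 hv.sys hv.l2w
  have h0 := tendsto_nhds_unique (E.wr F hV hV) hva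
  have hne : V1 x0 ≠ 0 ∨ V2 x0 ≠ 0 := by
    by_contra hcon
    push Not at hcon
    obtain ⟨h, hq, hw, hM, L, hL, hT⟩ := hvnd
    obtain ⟨U1, U2, hU⟩ := SLExt_exists hyp F i1 i2 hM.sys hM.l2w
    have := tendsto_nhds_unique (E.wr F hU hV) hT
    rw [hcon.1, hcon.2] at this
    simp at this
    exact hL this.symm
  obtain ⟨e1, e2, he, κ, hκ, k1, k2⟩ := exists_real_dir h0 hne
  refine ⟨e1, e2, he, fun f fq w Y1 Y2 hY => ?_⟩
  have hT := E.wr F hY hV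
  have hκc : conj κ ≠ 0 := by simpa using hκ
  have heq : Y1 x0 * conj (V2 x0) - Y2 x0 * conj (V1 x0) = conj κ * (Y1 x0 * e2 - Y2 x0 * e1) := by
    rw [k1, k2]; simp; ring
  rw [heq] at hT
  constructor
  · intro h
    have := tendsto_nhds_unique hT h
    exact (mul_eq_zero.1 this).resolve_left hκc
  · intro h
    rwa [h, mul_zero] at hT

lemma can_multiple {a b : ℝ} {r t1 t2 : ℝ → ℝ} (H : CanHyp a b r t1 t2) {e1 e2 : ℝ}
    (he : e1 ≠ 0 ∨ e2 ≠ 0) {z : ℂ} {Y1 Y2 : ℝ → ℂ} (hY : IsCan (Icc a b) r t1 t2 z Y1 Y2)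
    (ha : Y1 a * e2 - Y2 a * e1 = 0) : ∃ c : ℂ, ∀ x ∈ Icc a b,
      Y1 x = c * Cs1 a r t1 t2 e1 e2 z x ∧ Y2 x = c * Cs2 a r t1 t2 e1 e2 z x := by
  obtain ⟨f1, f2, hf⟩ := exists_compl he
  have hfc : (e1:ℂ) * f2 - e2 * f1 = 1 := by exact_mod_cast hf
  have hP := Cs_can H e1 e2 z
  have hQ := Cs_can H f1 f2 z
  obtain ⟨i1, i2⟩ := Cs_init a r t1 t2 e1 e2 z
  obtain ⟨j1, j2⟩ := Cs_init a r t1 t2 f1 f2 z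
  have haI : a ∈ Icc a b := left_mem_Icc.2 H.lt.le
  refine ⟨Y1 a * f2 - Y2 a * f1, fun x hx => ?_⟩
  have d1 := hY.det ordConnected_Icc hP x hx a haI
  have d2 := hY.det ordConnected_Icc hQ x hx a haI
  have d3 := hP.det ordConnected_Icc hQ x hx a haI
  rw [i1, i2] at d1 d3
  rw [j1, j2] at d2 d3
  rw [ha] at d1
  rw [hfc] at d3
  rw [← d2]
  constructor
  · linear_combination (-Y1 x) * d3 - Cs1 a r t1 t2 f1 f2 z x * d1
  · linear_combination (-Y2 x) * d3 - Cs2 a r t1 t2 f1 f2 z x * d1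

lemma spec_eq {a b : ℝ} {p q r s : ℝ → ℝ}
    (hlca : ∀ z : ℂ, ∀ u uq : ℝ → ℂ, SLSys a b p q r s u uq (fun x => z * u x) →
      ∀ c ∈ Set.Ioo a b, IntegrableOn (fun x => ‖u x‖ ^ 2 * r x) (Set.Ioo a c))
    (hlcb : ∀ z : ℂ, ∀ u uq : ℝ → ℂ, SLSys a b p q r s u uq (fun x => z * u x) →
      ∀ c ∈ Set.Ioo a b, IntegrableOn (fun x => ‖u x‖ ^ 2 * r x) (Set.Ioo c b))
    (hyp : SLHyp a b p q r s) {θ θq φ φq : ℝ → ℝ} (F : FS a b p q r s θ θq φ φq)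
    (H : CanHyp a b r θ φ)
    (i1 : IntegrableOn (fun t => r t * θ t ^ 2) (Ioo a b))
    (i2 : IntegrableOn (fun t => r t * φ t ^ 2) (Ioo a b))
    {v vq w wq : ℝ → ℂ} {e1 e2 k1 k2 : ℝ} (he : e1 ≠ 0 ∨ e2 ≠ 0)
    (hbe : ∀ f fq w Y1 Y2, SLExt a b r θ θq φ φq f fq w Y1 Y2 →
      (Tendsto (Wr f fq (fun x => conj (v x)) (fun x => conj (vq x))) (𝓝[>] a) (𝓝 0) ↔
        Y1 a * e2 - Y2 a * e1 = 0))
    (hbk : ∀ f fq h Y1 Y2, SLExt a b r θ θq φ φq f fq h Y1 Y2 →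
      (Tendsto (Wr f fq (fun x => conj (w x)) (fun x => conj (wq x))) (𝓝[<] b) (𝓝 0) ↔
        Y1 b * k2 - Y2 b * k1 = 0)) (t : ℝ) :
    t ∈ specSet a b p q r s v vq w wq ↔ Gf a b r θ φ e1 e2 k1 k2 t = 0 := by
  have hbI : b ∈ Icc a b := right_mem_Icc.2 H.lt.le
  have hab := H.lt
  have hne : ∀ c : ℝ, ∀ᵐ t : ℝ, t ≠ c := fun c => by simp [ae_iff, measure_singleton]
  constructor
  · rintro ⟨u, uq, hs, ⟨x, hx, hux⟩, h2, hTa, hTb⟩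
    have h2' : IntegrableOn (fun x => ‖(t:ℂ) * u x‖ ^ 2 * r x) (Ioo a b) := by
      refine IntegrableOn.congr_fun (h2.const_mul (t ^ 2)) (fun x _ => ?_) measurableSet_Ioo
      simp only [norm_mul, Complex.norm_real, Real.norm_eq_abs, mul_pow, sq_abs]; ring
    obtain ⟨Y1, Y2, hY⟩ := SLExt_exists hyp F i1 i2 hs h2'
    have hC : IsCan (Icc a b) r θ φ t Y1 Y2 := by
      refine ⟨hY.A1.congr_ae ordConnected_Icc ?_, hY.A2.congr_ae ordConnected_Icc ?_⟩
      all_goals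
        filter_upwards [hne a, hne b] with y h3 h4 h5
        rw [hY.e1 y ⟨lt_of_le_of_ne h5.1 h3.symm, lt_of_le_of_ne h5.2 h4⟩]
        ring
    obtain ⟨c, hc⟩ := can_multiple H he hC ((hbe _ _ _ _ _ hY).1 hTa)
    have hb := (hbk _ _ _ _ _ hY).1 hTb
    have hc0 : c ≠ 0 := by
      rintro rfl
      apply hux
      have := hc x (Ioo_subset_Icc_self hx)
      rw [hY.e1 x hx, this.1, this.2]; simp
    rw [(hc b hbI).1, (hc b hbI).2] at hb
    have : c * Gf a b r θ φ e1 e2 k1 k2 t = 0 := by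
      unfold Gf; linear_combination hb
    exact (mul_eq_zero.1 this).resolve_left hc0
  · intro hG
    have hP := Cs_can H e1 e2 t
    obtain ⟨j1, j2⟩ := Cs_init a r θ φ e1 e2 t
    unfold Gf at hG
    set P1 := Cs1 a r θ φ e1 e2 t with hP1
    set P2 := Cs2 a r θ φ e1 e2 t with hP2
    have hE : SLExt a b r θ θq φ φq (fun x => P1 x * θ x + P2 x * φ x) (fun x => P1 x * θq x + P2 x * φq x)
        (fun x => (t:ℂ) * (P1 x * θ x + P2 x * φ x)) P1 P2 :=
      ⟨hP.fst.congr ordConnected_Icc (fun _ _ => rfl) (fun x _ => by ring),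
       hP.snd.congr ordConnected_Icc (fun _ _ => rfl) (fun x _ => by ring),
       fun _ _ => rfl, fun _ _ => rfl⟩
    have a1 := hP.fst.mono (Ioo_subset_Icc_self (a := a) (b := b))
    have a2 := hP.snd.mono (Ioo_subset_Icc_self (a := a) (b := b))
    have hs : SLSys a b p q r s (fun x => P1 x * θ x + P2 x * φ x) (fun x => P1 x * θq x + P2 x * φq x)
        (fun x => (t:ℂ) * (P1 x * θ x + P2 x * φ x)) := by
      constructor
      · refine ((a1.mul ordConnected_Ioo F.th.fst).add (a2.mul ordConnected_Ioo F.ph.fst)).congr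
          ordConnected_Ioo (fun _ _ => rfl) (fun x hx => ?_)
        ring
      · refine ((a1.mul ordConnected_Ioo F.th.snd).add (a2.mul ordConnected_Ioo F.ph.snd)).congr
          ordConnected_Ioo (fun _ _ => rfl) (fun x hx => ?_)
        linear_combination ((r x * t * (P1 x * θ x + P2 x * φ x)) : ℂ) * F.wC hx
    have hc : (a + b) / 2 ∈ Ioo a b := ⟨by linarith, by linarith⟩
    refine ⟨_, _, hs, ?_, ?_, (hbe _ _ _ _ _ hE).2 ?_, (hbk _ _ _ _ _ hE).2 hG⟩
    · by_contra hcon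
      push Not at hcon
      have h0 := hP.const_of_u H (Eventually.of_forall fun x hx => by
        have := hcon x hx
        linear_combination this) a (left_mem_Icc.2 hab.le)
      rw [j1, j2] at h0
      rcases he with h | h
      · exact h (by exact_mod_cast h0.1)
      · exact h (by exact_mod_cast h0.2)
    · exact integrableOn_split hc (hlca t _ _ hs _ hc) (hlcb t _ _ hs _ hc)
    · rw [j1, j2]; ring

/-- If `τ` is in the limit circle case at both endpoints, the eigenvalues of a
self-adjoint realization `S` with separated boundary conditions are the zeros of an
entire function of Cartwright class; hence they have convergence exponent at most one,
and if `S` is semibounded then `∑ (1+|λ|)⁻¹ < ∞`. -/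
theorem limit_circle_eigenvalue_distribution {a b : ℝ} {p q r s : ℝ → ℝ}
    (hyp : SLHyp a b p q r s)
    (hlca : ∀ z : ℂ, ∀ u uq : ℝ → ℂ, SLSys a b p q r s u uq (fun x => z * u x) →
      ∀ c ∈ Set.Ioo a b, IntegrableOn (fun x => ‖u x‖ ^ 2 * r x) (Set.Ioo a c))
    (hlcb : ∀ z : ℂ, ∀ u uq : ℝ → ℂ, SLSys a b p q r s u uq (fun x => z * u x) →
      ∀ c ∈ Set.Ioo a b, IntegrableOn (fun x => ‖u x‖ ^ 2 * r x) (Set.Ioo c b))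
    {v vq vw w wq ww : ℝ → ℂ}
    (hv : MaxDom a b p q r s v vq vw) (hw : MaxDom a b p q r s w wq ww)
    (hva : Tendsto (Wr v vq (fun x => conj (v x)) (fun x => conj (vq x))) (𝓝[>] a) (𝓝 0))
    (hvnd : ∃ h hq hw : ℝ → ℂ, MaxDom a b p q r s h hq hw ∧ ∃ L : ℂ, L ≠ 0 ∧
      Tendsto (Wr h hq (fun x => conj (v x)) (fun x => conj (vq x))) (𝓝[>] a) (𝓝 L))
    (hwb : Tendsto (Wr w wq (fun x => conj (w x)) (fun x => conj (wq x))) (𝓝[<] b) (𝓝 0))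
    (hwnd : ∃ h hq hw : ℝ → ℂ, MaxDom a b p q r s h hq hw ∧ ∃ L : ℂ, L ≠ 0 ∧
      Tendsto (Wr h hq (fun x => conj (w x)) (fun x => conj (wq x))) (𝓝[<] b) (𝓝 L)) :
    (∃ G : ℂ → ℂ, CartwrightClass G ∧ (∃ z : ℂ, G z ≠ 0) ∧
      specSet a b p q r s v vq w wq = {t : ℝ | G (t : ℂ) = 0}) ∧
    (∀ ω : ℝ, 1 < ω →
      Summable fun t : specSet a b p q r s v vq w wq => (1 + |(t : ℝ)| ^ ω)⁻¹) ∧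
    ((BddAbove (specSet a b p q r s v vq w wq) ∨ BddBelow (specSet a b p q r s v vq w wq)) →
      Summable fun t : specSet a b p q r s v vq w wq => (1 + |(t : ℝ)|)⁻¹) := by
  obtain ⟨θ, θq, φ, φq, F⟩ := FS_exists hyp
  obtain ⟨H, i1, i2⟩ := FS.can hyp hlca hlcb F
  obtain ⟨e1, e2, he, hbe⟩ := (EP_left hyp.lt).bc hyp F i1 i2 hv hva hvnd
  obtain ⟨k1, k2, hk, hbk⟩ := (EP_right hyp.lt).bc hyp F i1 i2 hw hwb hwnd
  have hspec := spec_eq hlca hlcb hyp F H i1 i2 he hbe hbk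
  have hG := Gf_cartwright H k1 k2 he
  obtain ⟨C, τ, hb⟩ := hG.2.1
  have hI : Gf a b r θ φ e1 e2 k1 k2 I ≠ 0 := by
    intro h
    have := Gf_real H he hk h
    simp at this
  refine ⟨⟨_, hG, ⟨I, hI⟩, Set.ext hspec⟩, ?_, ?_⟩
  · intro ω hω
    exact zeros_summable hG.1 hb hI (fun t ht => (hspec t).1 ht) hω
  · rintro (⟨M, hM⟩ | ⟨m, hm⟩)
    · exact zeros_semibdd hG.1 hb (fun z hz => Gf_real H he hk hz) (e := -1) (m := -M) (Or.inr rfl)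
        hspec (fun t ht => by have := hM ht; linarith)
    · exact zeros_semibdd hG.1 hb (fun z hz => Gf_real H he hk hz) (e := 1) (m := m) (Or.inl rfl)
        hspec (fun t ht => by have := hm ht; linarith)
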